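/- Let (X,T) be a topological dynamical system, f ∈ C(X,ℝ), and μ an ergodic T-invariant Borel probability measure with h_μ(T) > 0. Then for μ-almost every x ∈ X there exists a closed subset B(x) ⊆ W^u(x,T) such that lim_{n→∞} diam(T^{-n} B(x)) = 0 and P(T,f,B(x)) ≥ P_μ(T,f). -/

import Mathlib

open Filter Set Topology MeasureTheory

noncomputable section

variable {X : Type*}

/-- Birkhoff sum `f_n(x) = ∑_{j<n} f(T^j x)`. -/
def birk (T : X → X) (f : X → ℝ) (n : ℕ) (x : X) : ℝ :=
  ∑ j ∈ Finset.range n, f (T^[j] x)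

/-- `P_n(T,f,δ,K)`: supremum of `∑_{x∈E} exp f_n(x)` over `(n,δ)`-separated
subsets `E ⊆ K`. -/
def sepPn [MetricSpace X] (T : X → X) (f : X → ℝ) (n : ℕ) (δ : ℝ) (K : Set X) : ℝ :=
  sSup { r : ℝ | ∃ E : Finset X, ↑E ⊆ K ∧
    (∀ x ∈ E, ∀ y ∈ E, x ≠ y → ∃ i < n, δ < dist (T^[i] x) (T^[i] y)) ∧
    r = ∑ x ∈ E, Real.exp (birk T f n x) }

/-- The topological pressure of `T` for the subset `K`:
`P(T,f,K) = lim_{δ→0} limsup_n (1/n) log P_n(T,f,δ,K)`; since the expression is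
nonincreasing in `δ`, the limit is the supremum over `δ > 0`. -/
def pres [MetricSpace X] (T : X → X) (f : X → ℝ) (K : Set X) : EReal :=
  ⨆ (δ : ℝ) (_ : 0 < δ), atTop.limsup fun n : ℕ =>
    ((Real.log (sepPn T f n δ K) / n : ℝ) : EReal)

/-- The `ε`-stable set `W^s_ε(x,T)`. -/
def epsStable [MetricSpace X] (T : X → X) (ε : ℝ) (x : X) : Set X :=
  { y | ∀ n : ℕ, dist (T^[n] x) (T^[n] y) ≤ ε }

/-- The topological pressure of the preimages of the `ε`-stable set of `x`:
`P_s(T,f,x,ε) = lim_{δ→0} limsup_n (1/n) log P_n(T,f,δ,T^{-n}W^s_ε(x,T))`. -/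
def Ps [MetricSpace X] (T : X → X) (f : X → ℝ) (x : X) (ε : ℝ) : EReal :=
  ⨆ (δ : ℝ) (_ : 0 < δ), atTop.limsup fun n : ℕ =>
    ((Real.log (sepPn T f n δ ((T^[n]) ⁻¹' epsStable T ε x)) / n : ℝ) : EReal)

/-- A finite open cover of `X`. -/
def IsOpenCover [TopologicalSpace X] (𝒰 : Finset (Set X)) : Prop :=
  (∀ U ∈ 𝒰, IsOpen U) ∧ ⋃₀ (𝒰 : Set (Set X)) = univ

/-- A finite Borel cover of `X`. -/
def IsBorelCover [MeasurableSpace X] (𝒱 : Finset (Set X)) : Prop :=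
  (∀ V ∈ 𝒱, MeasurableSet V) ∧ ⋃₀ (𝒱 : Set (Set X)) = univ

/-- `𝒱` refines the iterated cover `𝒰_0^{n-1} = ⋁_{i<n} T^{-i}𝒰`. -/
def RefinesIter (T : X → X) (𝒰 : Finset (Set X)) (n : ℕ) (𝒱 : Finset (Set X)) : Prop :=
  ∀ V ∈ 𝒱, ∃ g : Fin n → Set X, (∀ i, g i ∈ 𝒰) ∧ V ⊆ ⋂ i : Fin n, (T^[(i : ℕ)]) ⁻¹' g i

/-- `P_n(T,f,𝒰,K)`: infimum over finite Borel covers `𝒱` refining `𝒰_0^{n-1}` of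
`∑_{V∈𝒱} sup_{x ∈ V∩K} exp f_n(x)` (an empty summand contributes `0`, which is
`Real.sSup ∅`). -/
def covPn [MeasurableSpace X] (T : X → X) (f : X → ℝ) (𝒰 : Finset (Set X)) (n : ℕ)
    (K : Set X) : ℝ :=
  sInf { r : ℝ | ∃ 𝒱 : Finset (Set X), IsBorelCover 𝒱 ∧ RefinesIter T 𝒰 n 𝒱 ∧
    r = ∑ V ∈ 𝒱, sSup ((fun x => Real.exp (birk T f n x)) '' (V ∩ K)) }

/-- A finite Borel partition of `X`. -/
def IsFinPartition [MeasurableSpace X] (α : Finset (Set X)) : Prop :=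
  (∀ A ∈ α, MeasurableSet A) ∧ ⋃₀ (α : Set (Set X)) = univ ∧
    (α : Set (Set X)).Pairwise Disjoint

/-- `H_μ(⋁_{i<n} T^{-i}α)`, computed over all atoms `⋂_{i<n} T^{-i} A_i`. -/
def dynH [MeasurableSpace X] (μ : Measure X) (T : X → X) (α : Finset (Set X)) (n : ℕ) : ℝ :=
  ∑ g : Fin n → α, Real.negMulLog ((μ (⋂ i : Fin n, (T^[(i : ℕ)]) ⁻¹' (g i : Set X))).toReal)

/-- `h_μ(T,α) = lim_n (1/n) H_μ(α_0^{n-1})`, which for an invariant measure equals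
the infimum of `(1/n) H_μ(α_0^{n-1})` over `n ≥ 1`. -/
def entPart [MeasurableSpace X] (μ : Measure X) (T : X → X) (α : Finset (Set X)) : ℝ :=
  ⨅ n : ℕ, dynH μ T α (n + 1) / (n + 1 : ℝ)

/-- The measure-theoretic entropy `h_μ(T)`. -/
def mEnt [MeasurableSpace X] (μ : Measure X) (T : X → X) : EReal :=
  ⨆ (α : Finset (Set X)) (_ : IsFinPartition α), ((entPart μ T α : ℝ) : EReal)

/-- The measure-theoretic pressure `P_μ(T,f) = h_μ(T) + ∫ f dμ`. -/
def mPres [MeasurableSpace X] (μ : Measure X) (T : X → X) (f : X → ℝ) : EReal :=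
  mEnt μ T + ((∫ x, f x ∂μ : ℝ) : EReal)

/-- The stable set `W^s(x,T)`. -/
def stableSet [MetricSpace X] (T : X → X) (x : X) : Set X :=
  { y | Tendsto (fun n : ℕ => dist (T^[n] x) (T^[n] y)) atTop (𝓝 0) }

/-- A Cantor set: a nonempty compact perfect totally disconnected set. -/
def IsCantorSet [TopologicalSpace X] (C : Set X) : Prop :=
  C.Nonempty ∧ IsCompact C ∧ Perfect C ∧ IsTotallyDisconnected C

/-- A weakly mixing set for `T`. -/
def IsWeaklyMixingSet [TopologicalSpace X] (T : X → X) (A : Set X) : Prop :=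
  A.Nonempty ∧ IsClosed A ∧
  ∃ B : Set X, B ⊆ A ∧
    (∃ C : ℕ → Set X, (∀ n, IsCantorSet (C n)) ∧ B = ⋃ n, C n) ∧
    closure B = A ∧
    ∀ C : Set X, C ⊆ B → IsCantorSet C →
      ∀ g : C → X, Continuous g → (∀ c : C, g c ∈ A) →
        ∃ φ : ℕ → ℕ, StrictMono φ ∧
          ∀ c : C, Tendsto (fun i => T^[φ i] (c : X)) atTop (𝓝 (g c))

/-- The time shift of a finite set of labelled times. -/
def timeShift (s : ℤ) (A : Finset (ℕ × ℤ)) : Finset (ℕ × ℤ) := A.image fun v => (v.1, v.2 + s)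

/-- A monotone submodular set function on the finite sets of labelled times `(j, i)`, invariant
under time shifts. -/
structure IsShiftPolymatroid (h : Finset (ℕ × ℤ) → ℝ) : Prop where
  empty : h ∅ = 0
  mono : ∀ A B, A ⊆ B → h A ≤ h B
  submod : ∀ A B, h (A ∪ B) + h (A ∩ B) ≤ h A + h B
  shift : ∀ (s : ℤ) (A : Finset (ℕ × ℤ)), h (timeShift s A) = h A

/-- The union of the slices `p t` over the time window `[a, b)`. -/
def window (p : ℤ → Finset (ℕ × ℤ)) (a b : ℤ) : Finset (ℕ × ℤ) := (Finset.Ico a b).biUnion p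

/-- The conditional value `h(A | F)`. -/
def condVal (h : Finset (ℕ × ℤ) → ℝ) (A F : Finset (ℕ × ℤ)) : ℝ := h (A ∪ F) - h F

/-- A family of slices that is compatible with the time shift. -/
def IsEquivariant (p : ℤ → Finset (ℕ × ℤ)) : Prop := ∀ s t, timeShift s (p t) = p (t + s)

theorem mem_window {p : ℤ → Finset (ℕ × ℤ)} {a b : ℤ} {v : ℕ × ℤ} :
    v ∈ window p a b ↔ ∃ t, a ≤ t ∧ t < b ∧ v ∈ p t := by
  simp [window, and_assoc]

theorem timeShift_union (s : ℤ) (A B : Finset (ℕ × ℤ)) :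
    timeShift s (A ∪ B) = timeShift s A ∪ timeShift s B :=
  Finset.image_union _ _

theorem timeShift_window {p : ℤ → Finset (ℕ × ℤ)} (hp : IsEquivariant p) (s a b : ℤ) :
    timeShift s (window p a b) = window p (a + s) (b + s) := by
  ext v
  rw [timeShift, Finset.mem_image, mem_window]
  constructor
  · rintro ⟨w, hw, rfl⟩
    obtain ⟨t, h1, h2, h3⟩ := mem_window.1 hw
    refine ⟨t + s, by omega, by omega, ?_⟩
    rw [← hp s t]
    exact Finset.mem_image_of_mem _ h3
  · rintro ⟨t, h1, h2, h3⟩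
    have : t = (t - s) + s := by ring
    rw [this, ← hp s (t - s)] at h3
    obtain ⟨w, hw, rfl⟩ := Finset.mem_image.1 h3
    exact ⟨w, mem_window.2 ⟨t - s, by omega, by omega, hw⟩, rfl⟩

theorem timeShift_empty (s : ℤ) : timeShift s ∅ = ∅ := Finset.image_empty _

namespace IsShiftPolymatroid

variable {h : Finset (ℕ × ℤ) → ℝ}

theorem cond_nonneg (H : IsShiftPolymatroid h) (A F : Finset (ℕ × ℤ)) : 0 ≤ condVal h A F :=
  sub_nonneg.2 (H.mono _ _ Finset.subset_union_right)

theorem cond_anti (H : IsShiftPolymatroid h) (A : Finset (ℕ × ℤ)) {F G : Finset (ℕ × ℤ)}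
    (hFG : F ⊆ G) : condVal h A G ≤ condVal h A F := by
  have h1 := H.submod (A ∪ F) G
  have h2 := H.mono F ((A ∪ F) ∩ G) (Finset.subset_inter Finset.subset_union_right hFG)
  have h3 : A ∪ F ∪ G = A ∪ G := by rw [Finset.union_assoc, Finset.union_eq_right.2 hFG]
  rw [h3] at h1
  unfold condVal
  linarith

theorem cond_shift (H : IsShiftPolymatroid h) (s : ℤ) (A F : Finset (ℕ × ℤ)) :
    condVal h (timeShift s A) (timeShift s F) = condVal h A F := by
  unfold condVal
  rw [← timeShift_union]
  exact congrArg₂ _ (H.shift _ _) (H.shift _ _)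

theorem cond_empty (H : IsShiftPolymatroid h) (A : Finset (ℕ × ℤ)) : condVal h A ∅ = h A := by
  simp [condVal, H.empty]

end IsShiftPolymatroid

theorem condVal_union (h : Finset (ℕ × ℤ) → ℝ) (A B F : Finset (ℕ × ℤ)) :
    condVal h (A ∪ B) F = condVal h A F + condVal h B (A ∪ F) := by
  unfold condVal
  rw [show A ∪ B ∪ F = B ∪ (A ∪ F) by
    rw [← Finset.union_assoc, Finset.union_comm B A]]
  ring

theorem window_succ (p : ℤ → Finset (ℕ × ℤ)) (n : ℕ) :
    window p 0 ((n + 1 : ℕ) : ℤ) = window p 0 n ∪ p n := by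
  ext v
  simp only [mem_window, Finset.mem_union]
  constructor
  · rintro ⟨t, h1, h2, h3⟩
    rcases (show t < n ∨ t = n by push_cast at h2; omega) with h | rfl
    · exact Or.inl ⟨t, h1, h, h3⟩
    · exact Or.inr h3
  · rintro (⟨t, h1, h2, h3⟩ | h)
    · exact ⟨t, h1, by push_cast; omega, h3⟩
    · exact ⟨n, by omega, by push_cast; omega, h⟩

theorem window_zero (p : ℤ → Finset (ℕ × ℤ)) (a : ℤ) : window p a a = ∅ := by
  simp [window]

theorem window_union_slices (p w : ℤ → Finset (ℕ × ℤ)) (a b : ℤ) :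
    window (fun t => p t ∪ w t) a b = window p a b ∪ window w a b := by
  ext v
  simp only [mem_window, Finset.mem_union]
  grind

theorem window_subset (p : ℤ → Finset (ℕ × ℤ)) {a b a' b' : ℤ} (h1 : a' ≤ a) (h2 : b ≤ b') :
    window p a b ⊆ window p a' b' := by
  intro v hv
  obtain ⟨t, h3, h4, h5⟩ := mem_window.1 hv
  exact mem_window.2 ⟨t, by omega, by omega, h5⟩

namespace IsShiftPolymatroid

variable {h : Finset (ℕ × ℤ) → ℝ}

theorem chain_sum (H : IsShiftPolymatroid h) {p : ℤ → Finset (ℕ × ℤ)} (hp : IsEquivariant p)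
    (F : Finset (ℕ × ℤ)) (n : ℕ) :
    condVal h (window p 0 n) F =
      ∑ i ∈ Finset.range n, condVal h (p 0) (window p (-i) 0 ∪ timeShift (-i) F) := by
  induction n with
  | zero => simp [window_zero, condVal]
  | succ n ih =>
    rw [window_succ, condVal_union, Finset.sum_range_succ, ih, ← H.cond_shift (-n : ℤ) (p n),
      hp, timeShift_union, timeShift_window hp]
    simp

theorem cond_window_antitone (H : IsShiftPolymatroid h) (A : Finset (ℕ × ℤ))
    (p : ℤ → Finset (ℕ × ℤ)) : Antitone fun N : ℕ => condVal h A (window p (-N) 0) :=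
  fun _ _ hMN => H.cond_anti _ (window_subset _ (by omega) le_rfl)

/-- If every one-step conditional value given a long past is below `b`, the values of long
windows grow at most at rate `b + ε`. -/
theorem window_le (H : IsShiftPolymatroid h) {p : ℤ → Finset (ℕ × ℤ)} (hp : IsEquivariant p)
    {b : ℝ} {M : ℕ} (hb : condVal h (p 0) (window p (-M) 0) ≤ b) {ε : ℝ} (hε : 0 < ε) :
    ∃ n₀ : ℕ, ∀ n : ℕ, n₀ ≤ n → h (window p 0 n) ≤ n * (b + ε) := by
  obtain ⟨n₀, hn₀⟩ := exists_nat_ge (M * (condVal h (p 0) ∅ + |b|) / ε)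
  refine ⟨max n₀ M, fun n hn => ?_⟩
  have hnM : M ≤ n := (le_max_right _ _).trans hn
  have hnn : (n₀ : ℝ) ≤ n := by exact_mod_cast (le_max_left _ _).trans hn
  rw [← H.cond_empty (window p 0 n), H.chain_sum hp]
  simp only [timeShift_empty, Finset.union_empty]
  have hc : 0 ≤ condVal h (p 0) ∅ := H.cond_nonneg _ _
  have key : ∀ i ∈ Finset.range n, condVal h (p 0) (window p (-i) 0) ≤
      b + if i ∈ Finset.range M then (condVal h (p 0) ∅ + |b|) else 0 := by
    intro i _
    split_ifs with hi
    · have := H.cond_anti (p 0) (Finset.empty_subset (window p (-i) 0))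
      have := neg_abs_le b
      linarith
    · have := H.cond_window_antitone (p 0) p (show M ≤ i by simpa using hi)
      simp only at this
      linarith
  refine (Finset.sum_le_sum key).trans ?_
  rw [Finset.sum_add_distrib, ← Finset.sum_filter]
  have hf : (Finset.range n).filter (fun i => i ∈ Finset.range M) = Finset.range M := by
    ext i; simp; omega
  rw [hf]
  simp only [Finset.sum_const, Finset.card_range, nsmul_eq_mul]
  have : M * (condVal h (p 0) ∅ + |b|) ≤ n * ε := by
    rw [div_le_iff₀ hε] at hn₀
    nlinarith
  nlinarith

theorem le_cond_window (H : IsShiftPolymatroid h) {p : ℤ → Finset (ℕ × ℤ)} (hp : IsEquivariant p)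
    {c : ℝ} (hc : ∀ n : ℕ, c * (n + 1) ≤ h (window p 0 (n + 1 : ℕ))) (N : ℕ) :
    c ≤ condVal h (p 0) (window p (-N) 0) := by
  refine le_of_forall_pos_le_add fun ε hε => ?_
  obtain ⟨n₀, hn₀⟩ := H.window_le hp (le_refl (condVal h (p 0) (window p (-N) 0))) hε
  have h1 := hn₀ (n₀ + 1) (by omega)
  have h2 := hc n₀
  push_cast at h1 h2
  have : (0 : ℝ) < n₀ + 1 := by positivity
  nlinarith

theorem mul_le_cond_window (H : IsShiftPolymatroid h) {p : ℤ → Finset (ℕ × ℤ)}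
    (hp : IsEquivariant p) {c : ℝ} {F : Finset (ℕ × ℤ)} (n : ℕ)
    (hc : ∀ i : ℕ, i < n → c ≤ condVal h (p 0) (window p (-i) 0 ∪ timeShift (-i) F)) :
    n * c ≤ condVal h (window p 0 n) F := by
  rw [H.chain_sum hp]
  have := Finset.sum_le_sum (fun i hi => hc i (Finset.mem_range.1 hi))
  simpa using this

/-- The infimum of the one-step conditional values. -/
theorem exists_rate (H : IsShiftPolymatroid h) (p : ℤ → Finset (ℕ × ℤ)) {ε : ℝ} (hε : 0 < ε) :
    ∃ r : ℝ, (∀ N : ℕ, r ≤ condVal h (p 0) (window p (-N) 0)) ∧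
      ∃ M : ℕ, ∀ N : ℕ, M ≤ N → condVal h (p 0) (window p (-N) 0) ≤ r + ε := by
  have hbdd : BddBelow (range fun N : ℕ => condVal h (p 0) (window p (-N) 0)) :=
    ⟨0, by rintro _ ⟨N, rfl⟩; exact H.cond_nonneg _ _⟩
  refine ⟨⨅ N : ℕ, condVal h (p 0) (window p (-N) 0), fun N => ciInf_le hbdd N, ?_⟩
  obtain ⟨M, hM⟩ := exists_lt_of_ciInf_lt
    (show (⨅ N : ℕ, condVal h (p 0) (window p (-N) 0)) < _ from lt_add_of_pos_right _ hε)
  exact ⟨M, fun N hN => (H.cond_window_antitone (p 0) p hN).trans hM.le⟩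

/-- Conditioning on a sufficiently remote past of `w` costs little. -/
theorem exists_delay_slice (H : IsShiftPolymatroid h) {p w : ℤ → Finset (ℕ × ℤ)}
    (hp : IsEquivariant p) (hw : IsEquivariant w) {r : ℝ}
    (hr : ∀ N : ℕ, r ≤ condVal h (p 0) (window p (-N) 0)) {ε : ℝ} (hε : 0 < ε) :
    ∃ k : ℕ, ∀ N : ℕ,
      r - ε ≤ condVal h (p 0) (window p (-N) 0 ∪ window w (-N) (-k)) := by
  have hq : IsEquivariant fun t => p t ∪ w t := fun s t => by
    simp only [timeShift_union, hp s t, hw s t]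
  obtain ⟨R, hR, M, hM⟩ := H.exists_rate (fun t => p t ∪ w t) (half_pos hε)
  obtain ⟨n₀, hn₀⟩ := H.window_le hq (hM M le_rfl) (half_pos hε)
  refine ⟨n₀ + 1, fun N => ?_⟩
  set n := n₀ + 1 with hn
  set F := window (fun t => p t ∪ w t) (-N) 0 with hF
  have h1 : n * R ≤ condVal h (window (fun t => p t ∪ w t) 0 n) F := by
    refine H.mul_le_cond_window hq n fun i _ => ?_
    refine (hR (N + i)).trans (H.cond_anti _ ?_)
    rw [hF, timeShift_window hq]
    refine Finset.union_subset (window_subset _ (by push_cast; omega) le_rfl)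
      (window_subset _ (by push_cast; omega) (by omega))
  have h2 : n * r ≤ h (window p 0 n) := by
    rw [← H.cond_empty]
    refine H.mul_le_cond_window hp n fun i _ => ?_
    simpa [timeShift_empty] using hr i
  have h3 := hn₀ n (by omega)
  have h4 : condVal h (window w 0 n) (window p 0 n ∪ F) ≤ condVal h (window w 0 n) (window p 0 n) :=
    H.cond_anti _ Finset.subset_union_left
  have h5 : condVal h (window (fun t => p t ∪ w t) 0 n) F =
      condVal h (window p 0 n) F + condVal h (window w 0 n) (window p 0 n ∪ F) := by
    rw [window_union_slices, condVal_union]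
  have h6 : condVal h (window w 0 n) (window p 0 n) =
      h (window (fun t => p t ∪ w t) 0 n) - h (window p 0 n) := by
    rw [window_union_slices, condVal, Finset.union_comm]
  have h7 : condVal h (window p 0 n) F ≤
      n * condVal h (p 0) (window p (-N) 0 ∪ window w (-N) (-n)) := by
    rw [H.chain_sum hp]
    have : ∀ i ∈ Finset.range n, condVal h (p 0) (window p (-i) 0 ∪ timeShift (-i) F) ≤
        condVal h (p 0) (window p (-N) 0 ∪ window w (-N) (-n)) := by
      intro i hi
      have hi := Finset.mem_range.1 hi
      refine H.cond_anti _ ?_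
      rw [hF, timeShift_window hq, window_union_slices]
      intro v hv
      rcases Finset.mem_union.1 hv with hv | hv
      · obtain ⟨t, h1, h2, h3⟩ := mem_window.1 hv
        by_cases ht : -(i : ℤ) ≤ t
        · exact Finset.mem_union_left _ (mem_window.2 ⟨t, ht, h2, h3⟩)
        · exact Finset.mem_union_right _ (Finset.mem_union_left _
            (mem_window.2 ⟨t, by omega, by omega, h3⟩))
      · exact Finset.mem_union_right _ (Finset.mem_union_right _
          (window_subset _ (by omega) (by omega) hv))
    simpa using Finset.sum_le_sum this
  have hnpos : (0 : ℝ) < n := by rw [hn]; positivity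
  have h8 : (n : ℝ) * (r - ε) ≤ n * condVal h (p 0) (window p (-N) 0 ∪ window w (-N) (-n)) := by
    linarith
  exact le_of_mul_le_mul_left h8 hnpos

/-- A new process can be adjoined to the past, with a delay, at an arbitrarily small cost. -/
theorem exists_delay (H : IsShiftPolymatroid h) {p w : ℤ → Finset (ℕ × ℤ)}
    (hp : IsEquivariant p) (hw : IsEquivariant w) {b : Finset (ℕ × ℤ)} (hb : b ⊆ p 0) {c c' : ℝ}
    (hc : ∀ N : ℕ, c ≤ condVal h b (window p (-N) 0)) (hcc : c' < c) :
    ∃ k : ℕ, ∀ N : ℕ, c' ≤ condVal h b (window (fun t => p t ∪ w (t - k)) (-N) 0) := by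
  set ε := (c - c') / 2 with hε
  have hεpos : 0 < ε := by rw [hε]; linarith
  obtain ⟨r, hr, M, hM⟩ := H.exists_rate p hεpos
  obtain ⟨k, hk⟩ := H.exists_delay_slice hp hw hr hεpos
  refine ⟨k, fun N => ?_⟩
  set L := max M (N + k) with hL
  have hLM : M ≤ L := le_max_left _ _
  have hLN : N + k ≤ L := le_max_right _ _
  set P := window p (-L) 0 with hP
  set W := window w (-L) (-k) with hW
  have h1 := hM L hLM
  have h2 := hk L
  have h3 := hc L
  have h4 : condVal h b (P ∪ W) ≤ condVal h b (window (fun t => p t ∪ w (t - k)) (-N) 0) := by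
    refine H.cond_anti _ fun v hv => ?_
    obtain ⟨t, h1, h2, h3⟩ := mem_window.1 hv
    rcases Finset.mem_union.1 h3 with h3 | h3
    · exact Finset.mem_union_left _ (mem_window.2 ⟨t, by omega, h2, h3⟩)
    · exact Finset.mem_union_right _ (mem_window.2 ⟨t - k, by omega, by omega, h3⟩)
  have h5 : ∀ F, condVal h (p 0) F = condVal h b F + condVal h (p 0) (b ∪ F) := fun F => by
    rw [← condVal_union, Finset.union_eq_right.2 hb]
  have h6 : condVal h (p 0) (b ∪ (P ∪ W)) ≤ condVal h (p 0) (b ∪ P) :=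
    H.cond_anti _ (Finset.union_subset_union_right Finset.subset_union_left)
  have h7 := h5 P
  have h8 := h5 (P ∪ W)
  linarith

/-- A coherent increasing family of pasts containing all the columns from some time on, given
which column `0` keeps an entropy rate at least `c`. -/
theorem exists_past (H : IsShiftPolymatroid h) {c c₀ : ℝ} (hcc : c < c₀)
    (hc₀ : ∀ n : ℕ, c₀ * (n + 1) ≤ h (window (fun t => {(0, t)}) 0 (n + 1 : ℕ))) :
    ∃ F : ℕ → Finset (ℕ × ℤ), Monotone F ∧ (∀ i : ℕ, ∃ N, (0, -(i + 1 : ℤ)) ∈ F N) ∧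
      (∀ j, ∃ k : ℕ, ∀ i : ℕ, k ≤ i → ∃ N, (j, -(i : ℤ)) ∈ F N) ∧
      ∀ n N : ℕ, n * c ≤ condVal h (window (fun t => {(0, t)}) 0 n) (F N) := by
  have single : ∀ j, IsEquivariant fun t => {(j, t)} := fun j s t => by simp [timeShift]
  set e : ℕ → ℝ := fun J => c + (c₀ - c) / (J + 1) with he
  have e_anti : ∀ J, e (J + 1) < e J := fun J => by
    simp only [he]
    have : 0 < c₀ - c := sub_pos.2 hcc
    gcongr
    simp
  have e_ge : ∀ J, c ≤ e J := fun J => by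
    have : 0 < c₀ - c := sub_pos.2 hcc
    simp only [he]
    have : 0 ≤ (c₀ - c) / (J + 1) := by positivity
    linarith
  let Good : ℕ → (ℤ → Finset (ℕ × ℤ)) → Prop := fun J p =>
    IsEquivariant p ∧ {((0 : ℕ), (0 : ℤ))} ⊆ p 0 ∧
      ∀ N : ℕ, e J ≤ condVal h {(0, 0)} (window p (-N) 0)
  have step : ∀ J (p : {p // Good J p}), ∃ q : {p // Good (J + 1) p}, ∃ k : ℕ,
      q.1 = fun t => p.1 t ∪ {(J, t - k)} := by
    rintro J ⟨p, hp, hp0, hpc⟩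
    obtain ⟨k, hk⟩ := H.exists_delay hp (single J) hp0 hpc (e_anti J)
    refine ⟨⟨fun t => p t ∪ {(J, t - k)}, fun s t => ?_, hp0.trans Finset.subset_union_left, hk⟩,
      k, rfl⟩
    rw [timeShift_union, hp]
    simp [timeShift]
    ring_nf
  choose nxt k hk using step
  have good0 : Good 0 fun t => {(0, t)} :=
    ⟨single 0, by simp, fun N => by simpa [he] using H.le_cond_window (single 0) hc₀ N⟩
  let st : ∀ J, {p // Good J p} := fun J => Nat.rec ⟨_, good0⟩ (fun J p => nxt J p) J
  have st_succ : ∀ J t, (st (J + 1)).1 t = (st J).1 t ∪ {(J, t - (k J (st J) : ℤ))} :=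
    fun J t => congrFun (hk J (st J)) t
  have st_mono : ∀ t, Monotone fun J => (st J).1 t := fun t =>
    monotone_nat_of_le_succ fun J => by
      rw [st_succ]; exact Finset.subset_union_left
  refine ⟨fun N => window (st N).1 (-N) 0, ?_, ?_, ?_, ?_⟩
  · intro M N hMN v hv
    obtain ⟨t, h1, h2, h3⟩ := mem_window.1 hv
    exact mem_window.2 ⟨t, by omega, h2, st_mono t hMN h3⟩
  · intro i
    refine ⟨i + 1, mem_window.2 ⟨-(i + 1 : ℤ), by push_cast; omega, by omega, ?_⟩⟩
    exact st_mono (-(i + 1 : ℤ)) (Nat.zero_le (i + 1))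
      (show (0, -(i + 1 : ℤ)) ∈ (st 0).1 _ from Finset.mem_singleton_self _)
  · intro j
    refine ⟨k j (st j) + 1, fun i hi => ⟨i + j + 1, mem_window.2
      ⟨-(i : ℤ) + k j (st j), by push_cast; omega, by omega, ?_⟩⟩⟩
    refine st_mono _ (show j + 1 ≤ i + j + 1 by omega) ?_
    simp only
    rw [st_succ]
    simp
  · intro n N
    refine H.mul_le_cond_window (single 0) n fun i _ => ?_
    refine (e_ge (N + i)).trans (((st (N + i)).2.2.2 (N + i)).trans (H.cond_anti _ ?_))
    rw [timeShift_window (st N).2.1]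
    intro v hv
    rcases Finset.mem_union.1 hv with hv | hv <;>
      obtain ⟨t, h1, h2, h3⟩ := mem_window.1 hv
    · exact mem_window.2 ⟨t, by push_cast; omega, h2, st_mono t (Nat.zero_le _) h3⟩
    · exact mem_window.2 ⟨t, by push_cast; omega, by omega, st_mono t (Nat.le_add_right _ _) h3⟩

end IsShiftPolymatroid

/-- The Shannon entropy of a finite-valued function. -/
def shannon [MeasurableSpace X] (μ : Measure X) {α : Type*} [Fintype α] (Y : X → α) : ℝ :=
  ∑ a, Real.negMulLog (μ.real (Y ⁻¹' {a}))

theorem ae_fiber_pos [MeasurableSpace X] {μ : Measure X} [IsProbabilityMeasure μ] {α : Type*}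
    [Fintype α] (Y : X → α) : ∀ᵐ x ∂μ, 0 < μ.real (Y ⁻¹' {Y x}) := by
  have h : μ (⋃ a ∈ {a | μ (Y ⁻¹' {a}) = 0}, Y ⁻¹' {a}) = 0 :=
    (measure_biUnion_null_iff (Set.to_countable _)).2 fun a ha => ha
  rw [ae_iff]
  refine measure_mono_null (fun x hx => ?_) h
  simp only [mem_ofPred_eq, not_lt] at hx
  have hx : μ.real (Y ⁻¹' {Y x}) = 0 := le_antisymm hx measureReal_nonneg
  rw [measureReal_eq_zero_iff] at hx
  exact mem_biUnion (x := Y x) hx rfl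

theorem shannon_comp_measurePreserving [MeasurableSpace X] {μ : Measure X} {α : Type*} [Fintype α]
    [MeasurableSpace α] [MeasurableSingletonClass α] {Y : X → α} (hY : Measurable Y) {S : X → X}
    (hS : MeasurePreserving S μ μ) : shannon μ (fun x => Y (S x)) = shannon μ Y := by
  unfold shannon
  refine Finset.sum_congr rfl fun a _ => ?_
  rw [← hS.measureReal_preimage (hY (measurableSet_singleton a)).nullMeasurableSet]
  rfl

section Shannon

variable [MeasurableSpace X] {μ : Measure X} [IsProbabilityMeasure μ]
  {α β γ : Type*} [Fintype α] [MeasurableSpace α] [MeasurableSingletonClass α]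
  [Fintype β] [MeasurableSpace β] [MeasurableSingletonClass β]
  [Fintype γ] [MeasurableSpace γ] [MeasurableSingletonClass γ]

theorem integral_comp_fintype {Y : X → α} (hY : Measurable Y) (ψ : α → ℝ) :
    ∫ x, ψ (Y x) ∂μ = ∑ a, μ.real (Y ⁻¹' {a}) * ψ a := by
  have : IsProbabilityMeasure (μ.map Y) := Measure.isProbabilityMeasure_map hY.aemeasurable
  rw [← integral_map hY.aemeasurable (Measurable.of_discrete (f := ψ)).aestronglyMeasurable,
    integral_fintype Integrable.of_finite]
  simp [Measure.real, Measure.map_apply hY (measurableSet_singleton _)]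

theorem integrable_comp_fintype {Y : X → α} (hY : Measurable Y) (ψ : α → ℝ) :
    Integrable (fun x => ψ (Y x)) μ := by
  have : IsProbabilityMeasure (μ.map Y) := Measure.isProbabilityMeasure_map hY.aemeasurable
  exact (Integrable.of_finite (μ := μ.map Y) (f := ψ)).comp_measurable hY

theorem shannon_eq_integral {Y : X → α} (hY : Measurable Y) :
    shannon μ Y = ∫ x, -Real.log (μ.real (Y ⁻¹' {Y x})) ∂μ := by
  rw [integral_comp_fintype hY (fun a => -Real.log (μ.real (Y ⁻¹' {a})))]
  simp [shannon, Real.negMulLog]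

theorem integrable_log_fiber {Y : X → α} (hY : Measurable Y) :
    Integrable (fun x => Real.log (μ.real (Y ⁻¹' {Y x}))) μ :=
  integrable_comp_fintype hY fun a => Real.log (μ.real (Y ⁻¹' {a}))

theorem shannon_le_of_refines {Y : X → α} {Z : X → β} (hY : Measurable Y) (hZ : Measurable Z)
    (h : ∀ x y, Y x = Y y → Z x = Z y) : shannon μ Z ≤ shannon μ Y := by
  rw [shannon_eq_integral hY, shannon_eq_integral hZ]
  refine integral_mono_ae (integrable_log_fiber hZ).neg (integrable_log_fiber hY).neg ?_
  filter_upwards [ae_fiber_pos Y] with x hx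
  exact neg_le_neg (Real.log_le_log hx (measureReal_mono fun y hy => h y x hy))

theorem shannon_congr_ker {Y : X → α} {Z : X → β} (hY : Measurable Y) (hZ : Measurable Z)
    (h : ∀ x y, Y x = Y y ↔ Z x = Z y) : shannon μ Y = shannon μ Z :=
  le_antisymm (shannon_le_of_refines hZ hY fun x y => (h x y).2)
    (shannon_le_of_refines hY hZ fun x y => (h x y).1)

theorem sum_measureReal_fiber_inter {Y : X → α} (hY : Measurable Y) {s : Set X} :
    ∑ a, μ.real (Y ⁻¹' {a} ∩ s) = μ.real s := by
  have := sum_measureReal_preimage_singleton (μ := μ.restrict s) (f := Y) Finset.univ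
    (fun a _ => hY (measurableSet_singleton a))
  simpa [measureReal_restrict_apply (hY (measurableSet_singleton _))] using this

theorem shannon_submod {U : X → α} {V : X → β} {Z : X → γ} (hU : Measurable U)
    (hV : Measurable V) (hZ : Measurable Z) :
    shannon μ (fun x => (U x, V x, Z x)) + shannon μ Z ≤
      shannon μ (fun x => (U x, Z x)) + shannon μ (fun x => (V x, Z x)) := by
  set Y : X → α × β × γ := fun x => (U x, V x, Z x) with hYdef
  set UZ : X → α × γ := fun x => (U x, Z x) with hUZdef
  set VZ : X → β × γ := fun x => (V x, Z x) with hVZdef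
  have hY : Measurable Y := hU.prodMk (hV.prodMk hZ)
  have hUZ : Measurable UZ := hU.prodMk hZ
  have hVZ : Measurable VZ := hV.prodMk hZ
  set ψ : α × β × γ → ℝ := fun a => μ.real (UZ ⁻¹' {(a.1, a.2.2)}) * μ.real (VZ ⁻¹' {a.2}) /
    (μ.real (Y ⁻¹' {a}) * μ.real (Z ⁻¹' {a.2.2})) with hψ
  have key : ∫ x, (Real.log (μ.real (UZ ⁻¹' {UZ x})) + Real.log (μ.real (VZ ⁻¹' {VZ x}))
      - Real.log (μ.real (Y ⁻¹' {Y x})) - Real.log (μ.real (Z ⁻¹' {Z x}))) ∂μ ≤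
      ∫ x, (ψ (Y x) - 1) ∂μ := by
    refine integral_mono_ae (((integrable_log_fiber hUZ).add (integrable_log_fiber hVZ)).sub
      (integrable_log_fiber hY) |>.sub (integrable_log_fiber hZ))
      ((integrable_comp_fintype hY ψ).sub (integrable_const 1)) ?_
    filter_upwards [ae_fiber_pos Y, ae_fiber_pos UZ, ae_fiber_pos VZ, ae_fiber_pos Z]
      with x h1 h2 h3 h4
    have h5 : ψ (Y x) = μ.real (UZ ⁻¹' {UZ x}) * μ.real (VZ ⁻¹' {VZ x}) /
      (μ.real (Y ⁻¹' {Y x}) * μ.real (Z ⁻¹' {Z x})) := rfl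
    have h6 := Real.log_le_sub_one_of_pos (show 0 < ψ (Y x) by rw [h5]; positivity)
    rw [h5, Real.log_div (by positivity) (by positivity), Real.log_mul h2.ne' h3.ne',
      Real.log_mul h1.ne' h4.ne'] at h6
    simp only [h5]
    linarith
  have hψ1 : ∫ x, ψ (Y x) ∂μ ≤ 1 := by
    rw [integral_comp_fintype hY ψ]
    have h1 : ∀ a : α × β × γ, μ.real (Y ⁻¹' {a}) * ψ a ≤
        μ.real (UZ ⁻¹' {(a.1, a.2.2)}) * μ.real (VZ ⁻¹' {a.2}) / μ.real (Z ⁻¹' {a.2.2}) := by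
      intro a
      rcases (measureReal_nonneg (μ := μ) (s := Y ⁻¹' {a})).eq_or_lt with h | h
      · rw [← h, zero_mul]; positivity
      · refine le_of_eq ?_
        simp only [hψ]
        field_simp
    refine (Finset.sum_le_sum fun a _ => h1 a).trans ?_
    have h2 : ∀ c : γ, ∑ a, μ.real (UZ ⁻¹' {(a, c)}) = μ.real (Z ⁻¹' {c}) := fun c => by
      rw [← sum_measureReal_fiber_inter hU]
      refine Finset.sum_congr rfl fun a _ => ?_
      congr 1
      ext x; simp [hUZdef]
    have h3 : ∀ c : γ, ∑ b, μ.real (VZ ⁻¹' {(b, c)}) = μ.real (Z ⁻¹' {c}) := fun c => by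
      rw [← sum_measureReal_fiber_inter hV]
      refine Finset.sum_congr rfl fun a _ => ?_
      congr 1
      ext x; simp [hVZdef]
    calc ∑ a : α × β × γ, μ.real (UZ ⁻¹' {(a.1, a.2.2)}) * μ.real (VZ ⁻¹' {a.2}) /
          μ.real (Z ⁻¹' {a.2.2})
        = ∑ c, (∑ a, μ.real (UZ ⁻¹' {(a, c)})) * (∑ b, μ.real (VZ ⁻¹' {(b, c)})) /
            μ.real (Z ⁻¹' {c}) := by
          simp only [Fintype.sum_prod_type, Finset.sum_mul_sum, Finset.sum_div]
          rw [Finset.sum_comm' (t' := Finset.univ) (s' := fun _ => Finset.univ) (by simp)]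
          rw [Finset.sum_comm (s := (Finset.univ : Finset γ))]
          rw [Finset.sum_comm]
          refine Finset.sum_congr rfl fun a _ => ?_
          rw [Finset.sum_comm]
      _ ≤ ∑ c, μ.real (Z ⁻¹' {c}) := by
          refine Finset.sum_le_sum fun c _ => ?_
          rw [h2, h3, mul_self_div_self]
      _ = 1 := by
          have := sum_measureReal_fiber_inter (μ := μ) hZ (s := univ)
          simpa using this
  have hadd : Integrable (fun x => Real.log (μ.real (UZ ⁻¹' {UZ x})) +
      Real.log (μ.real (VZ ⁻¹' {VZ x}))) μ :=
    (integrable_log_fiber hUZ).add (integrable_log_fiber hVZ)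
  have hsub : Integrable (fun x => Real.log (μ.real (UZ ⁻¹' {UZ x})) +
      Real.log (μ.real (VZ ⁻¹' {VZ x})) - Real.log (μ.real (Y ⁻¹' {Y x}))) μ :=
    hadd.sub (integrable_log_fiber hY)
  rw [integral_sub (integrable_comp_fintype hY ψ) (integrable_const 1),
    integral_sub hsub (integrable_log_fiber hZ), integral_sub hadd (integrable_log_fiber hY),
    integral_add (integrable_log_fiber hUZ) (integrable_log_fiber hVZ)] at key
  simp only [integral_const, probReal_univ, smul_eq_mul, mul_one] at key
  rw [shannon_eq_integral hY, shannon_eq_integral hZ, shannon_eq_integral hUZ,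
    shannon_eq_integral hVZ]
  simp only [integral_neg]
  linarith

end Shannon

/-- The joint code of a finite set of labelled times: the symbols `W j (T^i x)`, `(j, i) ∈ F`. -/
def jointCode [TopologicalSpace X] {m : ℕ → ℕ} (W : ∀ j, X → Fin (m j)) (T : X ≃ₜ X)
    (F : Finset (ℕ × ℤ)) (x : X) (v : F) : Fin (m v.1.1) :=
  W v.1.1 ((T ^ v.1.2) x)

section JointCode

variable [TopologicalSpace X] {m : ℕ → ℕ} {W : ∀ j, X → Fin (m j)} {T : X ≃ₜ X}

theorem jointCode_eq_iff {F : Finset (ℕ × ℤ)} {x y : X} :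
    jointCode W T F x = jointCode W T F y ↔
      ∀ v ∈ F, W v.1 ((T ^ v.2) x) = W v.1 ((T ^ v.2) y) := by
  simp only [funext_iff, jointCode, Subtype.forall]

variable [MeasurableSpace X] [BorelSpace X] {μ : Measure X}

theorem measurable_jointCode (hW : ∀ j, Measurable (W j)) (F : Finset (ℕ × ℤ)) :
    Measurable (jointCode W T F) :=
  measurable_pi_iff.2 fun v => (hW v.1.1).comp (T ^ v.1.2).continuous.measurable

theorem measurePreserving_zpow (hT : MeasurePreserving T μ μ) (s : ℤ) :
    MeasurePreserving ⇑(T ^ s) μ μ := by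
  have nat : ∀ n : ℕ, MeasurePreserving ⇑(T ^ n) μ μ := fun n => by
    induction n with
    | zero => exact MeasurePreserving.id μ
    | succ n ih => rw [pow_succ]; exact ih.comp hT
  obtain ⟨n, rfl | rfl⟩ := s.eq_nat_or_neg
  · rw [zpow_natCast]; exact nat n
  · rw [zpow_neg, zpow_natCast]
    exact (nat n).symm (T ^ n).toMeasurableEquiv

theorem isShiftPolymatroid_shannon [IsProbabilityMeasure μ] (hT : MeasurePreserving T μ μ)
    (hW : ∀ j, Measurable (W j)) :
    IsShiftPolymatroid fun F => shannon μ (jointCode W T F) where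
  empty := by
    simp only [shannon, Fintype.sum_unique]
    rw [show jointCode W T ∅ ⁻¹' {default} = univ from
      eq_univ_of_forall fun x => Subsingleton.elim _ _]
    simp
  mono A B hAB := by
    refine shannon_le_of_refines (measurable_jointCode hW B) (measurable_jointCode hW A) ?_
    simp only [jointCode_eq_iff]
    exact fun x y h v hv => h v (hAB hv)
  submod A B := by
    have h := shannon_submod (μ := μ) (measurable_jointCode (T := T) hW A)
      (measurable_jointCode (T := T) hW B) (measurable_jointCode (T := T) hW (A ∩ B))
    have hA := measurable_jointCode (T := T) hW A
    have hB := measurable_jointCode (T := T) hW B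
    have hAB := measurable_jointCode (T := T) hW (A ∩ B)
    rw [shannon_congr_ker (hA.prodMk (hB.prodMk hAB)) (measurable_jointCode (T := T) hW (A ∪ B)),
      shannon_congr_ker (hA.prodMk hAB) hA, shannon_congr_ker (hB.prodMk hAB) hB] at h
    · exact h
    all_goals
      intro x y
      simp only [Prod.mk.injEq, jointCode_eq_iff, Finset.mem_union, Finset.mem_inter]
      grind
  shift s A := by
    have hA := measurable_jointCode (T := T) hW A
    rw [← shannon_comp_measurePreserving hA (measurePreserving_zpow hT s)]
    refine shannon_congr_ker (measurable_jointCode hW _)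
      (hA.comp (T ^ s).continuous.measurable) fun x y => ?_
    simp only [jointCode_eq_iff, timeShift, Finset.forall_mem_image, zpow_add,
      Homeomorph.mul_apply]

end JointCode

theorem exists_abs_le_of_continuous [TopologicalSpace X] [CompactSpace X] {f : X → ℝ}
    (hf : Continuous f) : ∃ b, ∀ x, |f x| ≤ b := by
  obtain ⟨b, hb⟩ := (isCompact_range hf).isBounded.exists_norm_le
  exact ⟨b, fun x => hb _ (mem_range_self x)⟩

/-- A finite set that is `(n, δ)`-separated for `T`. -/
def IsSeparatedFor [MetricSpace X] (T : X → X) (n : ℕ) (δ : ℝ) (E : Finset X) : Prop :=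
  ∀ x ∈ E, ∀ y ∈ E, x ≠ y → ∃ i < n, δ < dist (T^[i] x) (T^[i] y)

section Separated

variable {T : X → X} {f : X → ℝ} {n : ℕ} {δ b : ℝ}

theorem abs_birk_le (hf : ∀ x, |f x| ≤ b) (n : ℕ) (x : X) : |birk T f n x| ≤ n * b := by
  refine (Finset.abs_sum_le_sum_abs _ _).trans ?_
  simpa using Finset.sum_le_sum fun j (_ : j ∈ Finset.range n) => hf (T^[j] x)

theorem birk_add (T : X → X) (f : X → ℝ) (k n : ℕ) (x : X) :
    birk T f (n + k) x = birk T f k x + birk T f n (T^[k] x) := by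
  rw [add_comm n k, birk, Finset.sum_range_add]
  simp only [birk, ← Function.iterate_add_apply, add_comm]

variable [MetricSpace X]

theorem exists_card_le_pow [CompactSpace X] (hδ : 0 < δ) :
    ∃ M : ℕ, 0 < M ∧ ∀ (T : X → X) (n : ℕ) (E : Finset X), IsSeparatedFor T n δ E →
      E.card ≤ M ^ n := by
  obtain ⟨t, ht⟩ := isCompact_univ.elim_finite_subcover (fun x : X => Metric.ball x (δ / 2))
    (fun _ => Metric.isOpen_ball) fun x _ => mem_iUnion.2 ⟨x, Metric.mem_ball_self (half_pos hδ)⟩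
  have hc : ∀ x : X, ∃ y : t, dist x y < δ / 2 := fun x => by
    simpa using ht (mem_univ x)
  choose c hc using hc
  refine ⟨t.card + 1, Nat.succ_pos _, fun T n E hE => ?_⟩
  have : E.card ≤ (Finset.univ : Finset (Fin n → t)).card := by
    refine Finset.card_le_card_of_injOn (fun x i => c (T^[i] x)) (by simp) ?_
    intro x hx y hy hxy
    by_contra hne
    obtain ⟨i, hi, hd⟩ := hE x hx y hy hne
    have h1 := congrFun hxy ⟨i, hi⟩
    simp only at h1
    have h2 := hc (T^[i] x)
    have h3 := hc (T^[i] y)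
    rw [← h1] at h3
    have := dist_triangle_right (T^[i] x) (T^[i] y) (c (T^[i] x))
    linarith
  refine this.trans ?_
  simp only [Finset.card_univ, Fintype.card_fun, Fintype.card_fin, Fintype.card_coe]
  gcongr
  omega

/-- An exponential bound for all the weighted separated sums. -/
theorem exists_sum_exp_le [CompactSpace X] (T : X → X) (hf : ∀ x, |f x| ≤ b) (hδ : 0 < δ) :
    ∃ L : ℝ, ∀ (n : ℕ) (E : Finset X), IsSeparatedFor T n δ E →
      ∑ x ∈ E, Real.exp (birk T f n x) ≤ Real.exp (n * L) := by
  obtain ⟨M, hM, hcard⟩ := exists_card_le_pow (X := X) hδ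
  refine ⟨Real.log M + b, fun n E hE => ?_⟩
  have h1 : ∑ x ∈ E, Real.exp (birk T f n x) ≤ E.card * Real.exp (n * b) := by
    rw [← nsmul_eq_mul]
    exact Finset.sum_le_card_nsmul _ _ _ fun x _ =>
      Real.exp_le_exp.2 ((le_abs_self _).trans (abs_birk_le hf n x))
  have h2 : (E.card : ℝ) ≤ (M : ℝ) ^ n := by exact_mod_cast hcard T n E hE
  refine h1.trans ?_
  rw [mul_add, Real.exp_add, Real.exp_nat_mul (Real.log M),
    Real.exp_log (by exact_mod_cast hM)]
  gcongr

theorem sepPn_le {K : Set X} {v : ℝ}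
    (h : ∀ E : Finset X, ↑E ⊆ K → IsSeparatedFor T n δ E →
      ∑ x ∈ E, Real.exp (birk T f n x) ≤ v) : sepPn T f n δ K ≤ v := by
  refine csSup_le ⟨0, ∅, by simp⟩ ?_
  rintro _ ⟨E, h1, h2, rfl⟩
  exact h E h1 h2

theorem le_pres_of_frequently (hδ : 0 < δ) {c : ℝ} {B : Set X}
    (h : ∃ᶠ n : ℕ in atTop, Real.exp (n * c) ≤ sepPn T f n δ B) : (c : EReal) ≤ pres T f B := by
  refine le_iSup₂_of_le δ hδ (le_limsup_of_frequently_le ?_)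
  refine (h.and_eventually (eventually_gt_atTop 0)).mono fun n hn => ?_
  have h0 : (0 : ℝ) < n := by exact_mod_cast hn.2
  rw [EReal.coe_le_coe_iff, le_div_iff₀ h0, mul_comm]
  exact (Real.le_log_iff_exp_le ((Real.exp_pos _).trans_le hn.1)).2 hn.1

variable [CompactSpace X]

theorem sepPn_bddAbove (hf : ∀ x, |f x| ≤ b) (hδ : 0 < δ) (K : Set X) :
    BddAbove { r : ℝ | ∃ E : Finset X, ↑E ⊆ K ∧
      (∀ x ∈ E, ∀ y ∈ E, x ≠ y → ∃ i < n, δ < dist (T^[i] x) (T^[i] y)) ∧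
      r = ∑ x ∈ E, Real.exp (birk T f n x) } := by
  obtain ⟨L, hL⟩ := exists_sum_exp_le T hf hδ
  refine ⟨Real.exp (n * L), ?_⟩
  rintro _ ⟨E, -, hE, rfl⟩
  exact hL n E hE

theorem sum_le_sepPn (hf : ∀ x, |f x| ≤ b) (hδ : 0 < δ) {K : Set X} {E : Finset X}
    (hEK : ↑E ⊆ K) (hE : IsSeparatedFor T n δ E) :
    ∑ x ∈ E, Real.exp (birk T f n x) ≤ sepPn T f n δ K :=
  le_csSup (sepPn_bddAbove hf hδ K) ⟨E, hEK, hE, rfl⟩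

theorem sepPn_mono (hf : ∀ x, |f x| ≤ b) (hδ : 0 < δ) {K K' : Set X} (h : K ⊆ K') :
    sepPn T f n δ K ≤ sepPn T f n δ K' :=
  sepPn_le fun _ hE hs => sum_le_sepPn hf hδ (hE.trans h) hs

theorem sepPn_pos (hf : ∀ x, |f x| ≤ b) (hδ : 0 < δ) {K : Set X} (hK : K.Nonempty) :
    0 < sepPn T f n δ K := by
  obtain ⟨x, hx⟩ := hK
  refine (Real.exp_pos (birk T f n x)).trans_le ?_
  have := sum_le_sepPn (T := T) (n := n) hf hδ (K := K) (E := {x}) (by simpa using hx)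
    (by intro y hy z hz hyz; simp_all)
  simpa using this

theorem exists_sepPn_le (T : X → X) (hf : ∀ x, |f x| ≤ b) (hδ : 0 < δ) :
    ∃ L : ℝ, ∀ (n : ℕ) (K : Set X), sepPn T f n δ K ≤ Real.exp (n * L) := by
  obtain ⟨L, hL⟩ := exists_sum_exp_le T hf hδ
  exact ⟨L, fun n K => sepPn_le fun E _ hE => hL n E hE⟩

/-- A maximal separated subset is spanning. -/
theorem exists_separated_spanning (hδ : 0 < δ) (T : X → X) (n : ℕ) (C : Set X) :
    ∃ E : Finset X, ↑E ⊆ C ∧ IsSeparatedFor T n δ E ∧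
      ∀ x ∈ C, ∃ z ∈ E, ∀ i < n, dist (T^[i] x) (T^[i] z) ≤ δ := by
  obtain ⟨M, -, hcard⟩ := exists_card_le_pow (X := X) hδ
  set P : ℕ → Prop := fun k => ∃ E : Finset X, ↑E ⊆ C ∧ IsSeparatedFor T n δ E ∧ E.card = k
    with hP
  have hP0 : P 0 := ⟨∅, by simp, by simp [IsSeparatedFor], rfl⟩
  classical
  obtain ⟨E, hEC, hE, hEcard⟩ := Nat.findGreatest_spec (P := P) (Nat.zero_le (M ^ n)) hP0
  refine ⟨E, hEC, hE, fun x hx => ?_⟩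
  by_contra! hno
  have hxE : x ∉ E := fun hxE => by
    obtain ⟨i, -, hi⟩ := hno x hxE
    simp only [dist_self] at hi
    exact hδ.not_gt hi
  have hsep : IsSeparatedFor T n δ (insert x E) := by
    intro y hy z hz hyz
    rcases Finset.mem_insert.1 hy with rfl | hyE <;> rcases Finset.mem_insert.1 hz with rfl | hzE
    · exact absurd rfl hyz
    · exact hno z hzE
    · obtain ⟨i, hi, hd⟩ := hno y hyE
      exact ⟨i, hi, by rwa [dist_comm]⟩
    · exact hE y hyE z hzE hyz
  have hPs : P (Nat.findGreatest P (M ^ n) + 1) :=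
    ⟨insert x E, by simpa [insert_subset_iff] using ⟨hx, hEC⟩, hsep, by
      rw [Finset.card_insert_of_notMem hxE, hEcard]⟩
  have hle : Nat.findGreatest P (M ^ n) + 1 ≤ M ^ n := by
    obtain ⟨E', -, hE', h⟩ := hPs
    rw [← h]
    exact hcard T n E' hE'
  have := Nat.le_findGreatest hle hPs
  omega

/-- Lower bounds on the separated sums pass to decreasing intersections of closed sets. -/
theorem le_sepPn_iInter (hT : Continuous T) (hf : Continuous f) {δ' v : ℝ} (hδ' : 0 < δ')
    (hδ : δ' < δ) {K : ℕ → Set X} (hK : ∀ N, IsClosed (K N)) (hanti : Antitone K)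
    (hv : ∀ N, v < sepPn T f n δ (K N)) : v ≤ sepPn T f n δ' (⋂ N, K N) := by
  have hTi : ∀ i, Continuous T^[i] := fun i => hT.iterate i
  have hbirk : Continuous (birk T f n) :=
    continuous_finsetSum _ fun j _ => hf.comp (hTi j)
  obtain ⟨b, hb⟩ := exists_abs_le_of_continuous hf
  obtain ⟨M, -, hcard⟩ := exists_card_le_pow (X := X) (hδ'.trans hδ)
  set D : ∀ m : ℕ, ℕ → Set (Fin m → X) := fun m N => (⋂ a, (fun z => z a) ⁻¹' K N) ∩
    ((⋂ a, ⋂ a', ⋂ (_ : a ≠ a'), ⋃ i ∈ Finset.range n,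
      {z | δ ≤ dist (T^[i] (z a)) (T^[i] (z a'))}) ∩
    {z | v ≤ ∑ a, Real.exp (birk T f n (z a))}) with hD
  have D_closed : ∀ m N, IsClosed (D m N) := fun m N => by
    refine (isClosed_iInter fun a => (hK N).preimage (continuous_apply a)).inter
      (IsClosed.inter ?_ ?_)
    · exact isClosed_iInter fun a => isClosed_iInter fun a' => isClosed_iInter fun _ =>
        isClosed_biUnion_finset fun i _ => isClosed_le continuous_const
          (((hTi i).comp (continuous_apply a)).dist ((hTi i).comp (continuous_apply a')))
    · exact isClosed_le continuous_const (continuous_finsetSum _ fun a _ =>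
        Real.continuous_exp.comp (hbirk.comp (continuous_apply a)))
  have D_anti : ∀ m, Antitone (D m) := fun m N N' h =>
    inter_subset_inter_left _ (iInter_mono fun a => preimage_mono (hanti h))
  have D_ne : ∀ N, ∃ m ≤ M ^ n, (D m N).Nonempty := fun N => by
    obtain ⟨E, hEK, hE, hlt⟩ : ∃ E : Finset X, ↑E ⊆ K N ∧ IsSeparatedFor T n δ E ∧
        v < ∑ x ∈ E, Real.exp (birk T f n x) := by
      by_contra! h
      exact (hv N).not_ge (sepPn_le h)
    set e := E.equivFin.symm with he
    refine ⟨E.card, hcard T n E hE, fun a => e a, mem_iInter.2 fun a => hEK (e a).2, ?_, ?_⟩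
    · refine mem_iInter.2 fun a => mem_iInter.2 fun a' => mem_iInter.2 fun haa => ?_
      obtain ⟨i, hi, hd⟩ := hE _ (e a).2 _ (e a').2
        fun h => haa (e.injective (Subtype.ext h))
      exact mem_biUnion (Finset.mem_range.2 hi) hd.le
    · refine hlt.le.trans (le_of_eq ?_)
      rw [e.sum_comp fun x : E => Real.exp (birk T f n x)]
      exact (Finset.sum_coe_sort E fun x => Real.exp (birk T f n x)).symm
  obtain ⟨m, hm⟩ : ∃ m, ∀ N, (D m N).Nonempty := by
    by_contra! hno
    choose N hN using hno
    obtain ⟨m, hm, hne⟩ := D_ne ((Finset.range (M ^ n + 1)).sup N)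
    have h := D_anti m (Finset.le_sup (f := N) (Finset.mem_range.2 (Nat.lt_succ_of_le hm)))
    rw [hN m] at h
    exact hne.ne_empty (subset_empty_iff.1 h)
  obtain ⟨z, hz⟩ := IsCompact.nonempty_iInter_of_directed_nonempty_isCompact_isClosed (D m)
    ((D_anti m).directed_ge) hm (fun N => (D_closed m N).isCompact) (D_closed m)
  rw [mem_iInter] at hz
  have hsep : ∀ a a', a ≠ a' → ∃ i < n, δ' < dist (T^[i] (z a)) (T^[i] (z a')) := by
    intro a a' haa
    have := mem_iInter.1 (mem_iInter.1 (mem_iInter.1 (hz 0).2.1 a) a') haa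
    obtain ⟨i, hi, hd⟩ := mem_iUnion₂.1 this
    exact ⟨i, Finset.mem_range.1 hi, hδ.trans_le hd⟩
  have hinj : Function.Injective z := by
    intro a a' h
    by_contra haa
    obtain ⟨i, -, hd⟩ := hsep a a' haa
    rw [h, dist_self] at hd
    exact hδ'.not_gt hd
  classical
  have key := sum_le_sepPn (T := T) (n := n) hb hδ' (K := ⋂ N, K N)
    (E := Finset.univ.image z) ?_ ?_
  · rw [Finset.sum_image hinj.injOn] at key
    exact (hz 0).2.2.trans key
  · rw [Finset.coe_image]
    rintro _ ⟨a, -, rfl⟩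
    exact mem_iInter.2 fun N => mem_iInter.1 (hz N).1 a
  · intro x hx y hy hxy
    obtain ⟨a, -, rfl⟩ := Finset.mem_image.1 hx
    obtain ⟨a', -, rfl⟩ := Finset.mem_image.1 hy
    exact hsep a a' fun h => hxy (congrArg z h)

theorem sepPn_image_iterate_le (hf : ∀ x, |f x| ≤ b) (hδ : 0 < δ) (k : ℕ) (B : Set X) :
    sepPn T f n δ (T^[k] '' B) ≤ Real.exp (k * b) * sepPn T f (n + k) δ B := by
  refine sepPn_le fun E hEB hE => ?_
  have hg : ∀ y : X, ∃ x, y ∈ E → x ∈ B ∧ T^[k] x = y := fun y => by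
    by_cases hy : y ∈ E
    · obtain ⟨x, hx, rfl⟩ := hEB hy
      exact ⟨x, fun _ => ⟨hx, rfl⟩⟩
    · exact ⟨y, fun h => absurd h hy⟩
  choose g hg using hg
  classical
  have ginj : Set.InjOn g E := fun y hy z hz h => by
    rw [← (hg y hy).2, h, (hg z hz).2]
  have h1 : ∑ x ∈ E.image g, Real.exp (birk T f (n + k) x) ≤ sepPn T f (n + k) δ B := by
    refine sum_le_sepPn hf hδ ?_ ?_
    · rw [Finset.coe_image]
      rintro _ ⟨y, hy, rfl⟩
      exact (hg y hy).1
    · intro x hx x' hx' hne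
      obtain ⟨y, hy, rfl⟩ := Finset.mem_image.1 hx
      obtain ⟨y', hy', rfl⟩ := Finset.mem_image.1 hx'
      obtain ⟨i, hi, hd⟩ := hE y hy y' hy' fun h => hne (congrArg g h)
      refine ⟨i + k, by omega, ?_⟩
      rwa [Function.iterate_add_apply, Function.iterate_add_apply, (hg y hy).2, (hg y' hy').2]
  rw [Finset.sum_image ginj] at h1
  refine le_trans ?_ (mul_le_mul_of_nonneg_left h1 (Real.exp_pos _).le)
  rw [Finset.mul_sum]
  refine Finset.sum_le_sum fun y hy => ?_
  rw [← Real.exp_add, birk_add, (hg y hy).2]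
  have := neg_le_of_abs_le (abs_birk_le (T := T) hf k (g y))
  exact Real.exp_le_exp.2 (by linarith)

theorem frequently_le_sepPn_of_image (hf : ∀ x, |f x| ≤ b) (hδ : 0 < δ) {c c' : ℝ} (hc : c' < c)
    (k : ℕ) {B : Set X}
    (h : ∃ᶠ n : ℕ in atTop, Real.exp (n * c) ≤ sepPn T f n δ (T^[k] '' B)) :
    ∃ᶠ n : ℕ in atTop, Real.exp (n * c') ≤ sepPn T f n δ B := by
  rw [frequently_atTop] at h ⊢
  intro a
  obtain ⟨n₀, hn₀⟩ := exists_nat_ge ((k * b + k * c') / (c - c'))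
  obtain ⟨n, hn, hle⟩ := h (max a n₀)
  refine ⟨n + k, by have := le_max_left a n₀; omega, ?_⟩
  have h1 := hle.trans (sepPn_image_iterate_le hf hδ k B)
  have h2 : (n₀ : ℝ) ≤ n := by exact_mod_cast (le_max_right _ _).trans hn
  rw [div_le_iff₀ (sub_pos.2 hc)] at hn₀
  have h3 : Real.exp ((n + k : ℕ) * c') ≤ Real.exp (-(k * b)) * Real.exp (n * c) := by
    rw [← Real.exp_add]
    refine Real.exp_le_exp.2 ?_
    push_cast
    nlinarith [mul_le_mul_of_nonneg_right h2 (sub_pos.2 hc).le]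
  refine h3.trans ?_
  rw [Real.exp_neg, inv_mul_le_iff₀ (Real.exp_pos _)]
  exact h1

end Separated

/-- A Gibbs inequality relative to a finite-valued function `Y`: the conditional entropy of `Γ`
given `Y` plus the integral of an energy `u` is at most the mean logarithm of the conditional
partition function. -/
theorem shannon_sub_add_integral_le [MeasurableSpace X] {μ : Measure X} [IsProbabilityMeasure μ]
    {α β : Type*} [Fintype α] [MeasurableSpace α] [MeasurableSingletonClass α]
    [Fintype β] [MeasurableSpace β] [MeasurableSingletonClass β] {Γ : X → α} {Y : X → β}
    (hΓ : Measurable Γ) (hY : Measurable Y) {u : X → ℝ} (hu : Integrable u μ) {R : β → α → ℝ}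
    (hR : ∀ y g, 0 ≤ R y g) (huR : ∀ x, Real.exp (u x) ≤ R (Y x) (Γ x)) :
    shannon μ (fun x => (Γ x, Y x)) - shannon μ Y + ∫ x, u x ∂μ ≤
      ∫ x, Real.log (∑ g, R (Y x) g) ∂μ := by
  set Z : X → α × β := fun x => (Γ x, Y x) with hZdef
  have hZ : Measurable Z := hΓ.prodMk hY
  set ψ : α × β → ℝ := fun a =>
    μ.real (Y ⁻¹' {a.2}) * R a.2 a.1 / (μ.real (Z ⁻¹' {a}) * ∑ g, R a.2 g) with hψ
  have hS : ∀ y, 0 ≤ ∑ g, R y g := fun y => Finset.sum_nonneg fun g _ => hR y g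
  have hψ1 : ∫ x, ψ (Z x) ∂μ ≤ 1 := by
    rw [integral_comp_fintype hZ, Fintype.sum_prod_type_right]
    have h1 : ∑ y, μ.real (Y ⁻¹' {y}) = 1 := by
      simpa using sum_measureReal_fiber_inter (μ := μ) hY (s := univ)
    rw [← h1]
    refine Finset.sum_le_sum fun y _ => ?_
    calc ∑ g, μ.real (Z ⁻¹' {(g, y)}) * ψ (g, y)
        ≤ ∑ g, μ.real (Y ⁻¹' {y}) * (R y g / ∑ g, R y g) := by
          refine Finset.sum_le_sum fun g _ => ?_
          simp only [hψ]
          rcases eq_or_ne (μ.real (Z ⁻¹' {(g, y)})) 0 with h0 | h0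
          · rw [h0, zero_mul]
            exact mul_nonneg measureReal_nonneg (div_nonneg (hR y g) (hS y))
          · rw [mul_div_assoc', mul_div_mul_left _ _ h0, mul_div_assoc]
      _ = μ.real (Y ⁻¹' {y}) * ((∑ g, R y g) / ∑ g, R y g) := by
          rw [← Finset.mul_sum, ← Finset.sum_div]
      _ ≤ μ.real (Y ⁻¹' {y}) :=
          mul_le_of_le_one_right measureReal_nonneg (div_self_le_one _)
  have hiS : Integrable (fun x => Real.log (∑ g, R (Y x) g)) μ :=
    integrable_comp_fintype hY fun y => Real.log (∑ g, R y g)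
  have hiψ : Integrable (fun x => ψ (Z x)) μ := integrable_comp_fintype hZ ψ
  have hiZ := integrable_log_fiber (μ := μ) hZ
  have hiY := integrable_log_fiber (μ := μ) hY
  have hpt : ∀ᵐ x ∂μ, u x ≤ Real.log (∑ g, R (Y x) g) + Real.log (μ.real (Z ⁻¹' {Z x})) -
      Real.log (μ.real (Y ⁻¹' {Y x})) + (ψ (Z x) - 1) := by
    filter_upwards [ae_fiber_pos Z, ae_fiber_pos Y] with x hp hq
    have hRx : 0 < R (Y x) (Γ x) := (Real.exp_pos _).trans_le (huR x)
    have hSx : 0 < ∑ g, R (Y x) g :=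
      hRx.trans_le (Finset.single_le_sum (fun g _ => hR (Y x) g) (Finset.mem_univ (Γ x)))
    have h1 : u x ≤ Real.log (R (Y x) (Γ x)) := (Real.le_log_iff_exp_le hRx).2 (huR x)
    have h2 := Real.log_le_sub_one_of_pos
      (show 0 < ψ (Z x) from div_pos (mul_pos hq hRx) (mul_pos hp hSx))
    simp only [hψ] at h2 ⊢
    rw [Real.log_div (mul_pos hq hRx).ne' (mul_pos hp hSx).ne',
      Real.log_mul hq.ne' hRx.ne', Real.log_mul hp.ne' hSx.ne'] at h2
    simp only [hZdef] at h1 h2 ⊢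
    linarith
  have hle := integral_mono_ae hu (((hiS.add hiZ).sub hiY).add (hiψ.sub (integrable_const 1))) hpt
  rw [integral_add' ((hiS.add hiZ).sub hiY) (hiψ.sub (integrable_const 1)),
    integral_sub' (hiS.add hiZ) hiY, integral_add' hiS hiZ,
    integral_sub' hiψ (integrable_const 1)] at hle
  simp only [integral_const, probReal_univ, smul_eq_mul, mul_one] at hle
  rw [shannon_eq_integral hZ, shannon_eq_integral hY, integral_neg, integral_neg]
  linarith

/-- If at each scale-`δ` ball the symbol of an unmarked point is determined, then the weighted
count of names seen in `C` is controlled by the separated sum of `C`. -/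
theorem exists_name_weight [MetricSpace X] [CompactSpace X] {ι : Type*} [Fintype ι]
    {T : X → X} {f : X → ℝ} {b δ η t : ℝ} (hf : ∀ x, |f x| ≤ b) (hδ : 0 < δ)
    (hη : ∀ x z, dist x z ≤ δ → f x ≤ f z + η) {γ : X → ι × Bool}
    (hγ : ∀ z, ∃ i, ∀ x, dist x z ≤ δ → γ x = (i, false) ∨ (γ x).2 = true) (n : ℕ) (C : Set X) :
    ∃ R : (Fin n → ι × Bool) → ℝ, (∀ g, 0 ≤ R g) ∧
      (∀ x ∈ C, Real.exp (birk T (fun x => f x - if (γ x).2 then t else 0) n x) ≤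
        R fun i => γ (T^[i] x)) ∧
      ∑ g, R g ≤ (Real.exp η * (1 + Fintype.card ι * Real.exp (-t))) ^ n * sepPn T f n δ C := by
  classical
  choose c hc using hγ
  obtain ⟨E, hEC, hE, hspan⟩ := exists_separated_spanning hδ T n C
  set w : X → ι × Bool → ℝ := fun z s =>
    Real.exp η * ((if s = (c z, false) then 1 else 0) + if s.2 then Real.exp (-t) else 0) with hw
  have hw0 : ∀ z s, 0 ≤ w z s := fun z s => by
    simp only [hw]
    positivity
  have hwsum : ∀ z, ∑ s, w z s = Real.exp η * (1 + Fintype.card ι * Real.exp (-t)) := fun z => by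
    simp only [hw]
    rw [← Finset.mul_sum, Finset.sum_add_distrib, Fintype.sum_prod_type (f := fun s : ι × Bool =>
      if s.2 then Real.exp (-t) else 0)]
    simp
  have hstep : ∀ x z, dist x z ≤ δ →
      Real.exp (f x - if (γ x).2 then t else 0) ≤ Real.exp (f z) * w z (γ x) := by
    intro x z hxz
    simp only [hw]
    rw [← mul_assoc, ← Real.exp_add]
    rcases hc z x hxz with h | h
    · simpa [h] using hη x z hxz
    · rw [if_pos h, if_pos h, sub_eq_add_neg, Real.exp_add]
      have h1 : Real.exp (f x) ≤ Real.exp (f z + η) := Real.exp_le_exp.2 (hη x z hxz)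
      have h2 : Real.exp (-t) ≤ (if γ x = (c z, false) then 1 else 0) + Real.exp (-t) :=
        le_add_of_nonneg_left (by positivity)
      gcongr
  have hexp : ∀ (φ : X → ℝ) x, Real.exp (birk T φ n x) = ∏ i : Fin n, Real.exp (φ (T^[i] x)) := by
    intro φ x
    rw [birk, Real.exp_sum, Finset.prod_range]
  refine ⟨fun g => ∑ z ∈ E, Real.exp (birk T f n z) * ∏ i : Fin n, w (T^[i] z) (g i), fun g => ?_,
    fun x hx => ?_, ?_⟩
  · exact Finset.sum_nonneg fun z _ => mul_nonneg (Real.exp_pos _).le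
      (Finset.prod_nonneg fun i _ => hw0 _ _)
  · obtain ⟨z, hz, hd⟩ := hspan x hx
    refine le_trans ?_ (Finset.single_le_sum (f := fun z => Real.exp (birk T f n z) *
      ∏ i : Fin n, w (T^[i] z) (γ (T^[i] x))) (fun z _ => mul_nonneg (Real.exp_pos _).le
      (Finset.prod_nonneg fun i _ => hw0 _ _)) hz)
    simp only [hexp]
    rw [← Finset.prod_mul_distrib]
    exact Finset.prod_le_prod (fun _ _ => (Real.exp_pos _).le) fun i _ => hstep _ _ (hd i i.2)
  · rw [Finset.sum_comm]
    have h1 : ∀ z, ∑ g : Fin n → ι × Bool,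
        Real.exp (birk T f n z) * ∏ i : Fin n, w (T^[i] z) (g i) =
        Real.exp (birk T f n z) * (Real.exp η * (1 + Fintype.card ι * Real.exp (-t))) ^ n := by
      intro z
      rw [← Finset.mul_sum, ← Fintype.prod_sum fun (i : Fin n) s => w (T^[i] z) s]
      simp [hwsum]
    simp only [h1]
    rw [← Finset.sum_mul, mul_comm]
    gcongr
    exact sum_le_sepPn hf hδ hEC hE

theorem exists_measurable_code_dist_le [MetricSpace X] [CompactSpace X] [MeasurableSpace X]
    [BorelSpace X] {ρ : ℝ} (hρ : 0 < ρ) :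
    ∃ (m : ℕ) (W : X → Fin m), Measurable W ∧ ∀ x y, W x = W y → dist x y ≤ ρ := by
  classical
  obtain ⟨t, ht⟩ := isCompact_univ.elim_finite_subcover (fun x : X => Metric.ball x (ρ / 2))
    (fun _ => Metric.isOpen_ball) fun x _ => mem_iUnion.2 ⟨x, Metric.mem_ball_self (half_pos hρ)⟩
  set V : X → t → Bool := fun x y => decide (x ∈ Metric.ball (y : X) (ρ / 2)) with hV
  have hVm : Measurable V := measurable_pi_iff.2 fun y => measurable_to_bool (by
    rw [show (fun x => V x y) ⁻¹' {true} = Metric.ball (y : X) (ρ / 2) by ext; simp [hV]]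
    exact Metric.isOpen_ball.measurableSet)
  refine ⟨_, fun x => Fintype.equivFin (t → Bool) (V x),
    (Measurable.of_discrete (f := Fintype.equivFin (t → Bool))).comp hVm, fun x y hxy => ?_⟩
  have h := (Fintype.equivFin (t → Bool)).injective hxy
  obtain ⟨z, hz, hx⟩ := mem_iUnion₂.1 (ht (mem_univ x))
  have h1 := congrFun h ⟨z, hz⟩
  simp only [hV, decide_eq_decide] at h1
  have hy := Metric.mem_ball.1 (h1.1 hx)
  have := dist_triangle_right x y z
  linarith [Metric.mem_ball.1 hx]

/-- Outside a small set, a measurable symbol is locally constant at a uniform scale. -/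
theorem exists_exceptional_set [MetricSpace X] [CompactSpace X] [MeasurableSpace X]
    [BorelSpace X] (μ : Measure X) [IsProbabilityMeasure μ] {ι : Type*} [Fintype ι]
    [MeasurableSpace ι] [MeasurableSingletonClass ι] {a : X → ι} (ha : Measurable a) {κ : ℝ}
    (hκ : 0 < κ) :
    ∃ δ > 0, ∃ D : Set X, MeasurableSet D ∧ μ.real D ≤ κ ∧
      ∀ z, ∃ i, ∀ x, dist x z ≤ δ → x ∉ D → a x = i := by
  have hA : ∀ i, MeasurableSet (a ⁻¹' {i}) := fun i => ha (measurableSet_singleton i)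
  set κ' : ℝ := κ / (Fintype.card ι + 1) with hκ'
  have hκ'0 : 0 < κ' := by positivity
  choose K hKA hKc hKμ using fun i => (hA i).exists_isClosed_sdiff_lt (measure_ne_top μ _)
    (ENNReal.ofReal_pos.2 hκ'0).ne'
  have hU : ∀ i, IsOpen (⋃ j ∈ {j | j ≠ i}, K j)ᶜ := fun i =>
    (Set.Finite.isClosed_biUnion (Set.toFinite _) fun j _ => hKc j).isOpen_compl
  obtain ⟨δ, hδ, hball⟩ := lebesgue_number_lemma_of_metric isCompact_univ hU (fun z _ => by
    refine mem_iUnion.2 ⟨a z, fun hz => ?_⟩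
    obtain ⟨j, hj, hzj⟩ := mem_iUnion₂.1 hz
    exact hj (hKA j hzj).symm)
  refine ⟨δ / 2, half_pos hδ, ⋃ i, a ⁻¹' {i} \ K i,
    MeasurableSet.iUnion fun i => (hA i).diff (hKc i).measurableSet, ?_, fun z => ?_⟩
  · refine (measureReal_iUnion_fintype_le _).trans ?_
    have h1 : ∀ i, μ.real (a ⁻¹' {i} \ K i) ≤ κ' := fun i =>
      ENNReal.toReal_le_of_le_ofReal hκ'0.le (hKμ i).le
    refine (Finset.sum_le_sum fun i _ => h1 i).trans ?_
    rw [Finset.sum_const, Finset.card_univ, nsmul_eq_mul, hκ', mul_div_assoc',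
      div_le_iff₀ (by positivity)]
    nlinarith
  · obtain ⟨i, hi⟩ := hball z (mem_univ z)
    refine ⟨i, fun x hx hxD => ?_⟩
    by_contra hne
    have hxK : x ∈ K (a x) := by
      by_contra h
      exact hxD (mem_iUnion.2 ⟨a x, rfl, h⟩)
    exact hi (Metric.mem_ball.2 (hx.trans_lt (half_lt_self hδ))) (mem_biUnion hne hxK)

theorem IsFinPartition.exists_code [MeasurableSpace X] {α : Finset (Set X)}
    (hα : IsFinPartition α) : ∃ (k : ℕ) (a : X → Fin k), Measurable a ∧
      ∀ (μ : Measure X) (T : X → X) (n : ℕ),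
        dynH μ T α n = shannon μ fun x (i : Fin n) => a (T^[i] x) := by
  obtain ⟨hm, hcov, hdisj⟩ := hα
  have hex : ∀ x, ∃ A : α, x ∈ (A : Set X) := fun x => by
    obtain ⟨A, hA, hx⟩ := mem_sUnion.1 (hcov.symm ▸ mem_univ x : x ∈ ⋃₀ (α : Set (Set X)))
    exact ⟨⟨A, hA⟩, hx⟩
  choose b hb using hex
  set e := Fintype.equivFin α
  have hbA : ∀ x (A : α), b x = A ↔ x ∈ (A : Set X) := fun x A => by
    refine ⟨fun h => h ▸ hb x, fun h => ?_⟩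
    by_contra hne
    exact (hdisj (b x).2 A.2 fun h => hne (Subtype.ext h)).le_bot ⟨hb x, h⟩
  refine ⟨_, fun x => e (b x), measurable_to_countable' fun i => ?_, fun μ T n => ?_⟩
  · have : (fun x => e (b x)) ⁻¹' {i} = (e.symm i : Set X) := by
      ext x
      simp [← hbA, Equiv.eq_symm_apply]
    rw [this]
    exact hm _ (e.symm i).2
  · refine Fintype.sum_equiv ((Equiv.refl (Fin n)).arrowCongr e) _ _ fun g => ?_
    congr 3
    ext x
    simp [funext_iff, ← hbA]

theorem integral_birk [MeasurableSpace X] {μ : Measure X} {T : X → X}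
    (hT : MeasurePreserving T μ μ) {φ : X → ℝ} (hφ : Integrable φ μ) (n : ℕ) :
    Integrable (birk T φ n) μ ∧ ∫ x, birk T φ n x ∂μ = n * ∫ x, φ x ∂μ := by
  have hi : ∀ j, Integrable (fun x => φ (T^[j] x)) μ := fun j =>
    (hT.iterate j).integrable_comp_of_integrable hφ
  refine ⟨integrable_finsetSum _ fun j _ => hi j, ?_⟩
  simp only [birk]
  rw [integral_finsetSum _ fun j _ => hi j]
  have : ∀ j, ∫ x, φ (T^[j] x) ∂μ = ∫ x, φ x ∂μ := fun j => by
    have h := (hT.iterate j)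
    conv_rhs => rw [← h.map_eq]
    exact (integral_map h.aemeasurable (by rw [h.map_eq]; exact hφ.aestronglyMeasurable)).symm
  simp [this]

theorem Homeomorph.coe_zpow_natCast [TopologicalSpace X] (T : X ≃ₜ X) (n : ℕ) :
    ⇑(T ^ (n : ℤ)) = T^[n] := by
  rw [zpow_natCast]
  induction n with
  | zero => rfl
  | succ n ih => rw [pow_succ, Function.iterate_succ, ← ih]; rfl

theorem Homeomorph.coe_zpow_neg_natCast [TopologicalSpace X] (T : X ≃ₜ X) (n : ℕ) :
    ⇑(T ^ (-(n : ℤ))) = T.symm^[n] := by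
  rw [← Homeomorph.coe_zpow_natCast, zpow_neg, ← inv_zpow]
  rfl

theorem entPart_mul_le_dynH [MeasurableSpace X] (μ : Measure X) [IsProbabilityMeasure μ]
    (T : X → X) (α : Finset (Set X)) (n : ℕ) :
    entPart μ T α * (n + 1) ≤ dynH μ T α (n + 1) := by
  have h0 : ∀ n, 0 ≤ dynH μ T α n := fun n => Finset.sum_nonneg fun g _ =>
    Real.negMulLog_nonneg measureReal_nonneg measureReal_le_one
  rw [← le_div_iff₀ (by positivity)]
  refine ciInf_le ⟨0, ?_⟩ n
  rintro _ ⟨k, rfl⟩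
  exact div_nonneg (h0 _) (by positivity)

/-- Codes `W j` of mesh `r j → 0` and an increasing sequence `F` of finite sets of past
coordinates such that the separated sums on the atoms of the past grow in the mean at rate `c`. -/
theorem exists_past_codes [MetricSpace X] [CompactSpace X] [MeasurableSpace X] [BorelSpace X]
    {μ : Measure X} [IsProbabilityMeasure μ] {T : X ≃ₜ X} (hT : MeasurePreserving T μ μ)
    {f : X → ℝ} (hf : Continuous f) {α : Finset (Set X)} (hα : IsFinPartition α) {c : ℝ}
    (hc : c < entPart μ T α + ∫ x, f x ∂μ) {ρ : ℝ} (hρ : 0 < ρ) :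
    ∃ (m : ℕ → ℕ) (W : ∀ j, X → Fin (m j)) (r : ℕ → ℝ) (F : ℕ → Finset (ℕ × ℤ)) (δ : ℝ),
      0 < δ ∧ (∀ j, Measurable (W j)) ∧ (∀ j x y, W j x = W j y → dist x y ≤ r j) ∧ r 0 = ρ ∧
      Tendsto r atTop (𝓝 0) ∧ Monotone F ∧ (∀ i : ℕ, ∃ N, (0, -(i + 1 : ℤ)) ∈ F N) ∧
      (∀ j, ∃ k : ℕ, ∀ i : ℕ, k ≤ i → ∃ N, (j, -(i : ℤ)) ∈ F N) ∧
      ∀ n N : ℕ, n * c ≤ ∫ x, Real.log (sepPn T f n δ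
        (jointCode W T (F N) ⁻¹' {jointCode W T (F N) x})) ∂μ := by
  classical
  obtain ⟨b, hb⟩ := exists_abs_le_of_continuous hf
  have hfi : Integrable f μ := Integrable.of_bound hf.aestronglyMeasurable b (ae_of_all _ hb)
  obtain ⟨ε, hε, hcε⟩ : ∃ ε > 0, c + 4 * ε = entPart μ T α + ∫ x, f x ∂μ :=
    ⟨(entPart μ T α + ∫ x, f x ∂μ - c) / 4, by linarith, by ring⟩
  obtain ⟨k, a₁, ha₁, hdyn⟩ := hα.exists_code
  obtain ⟨m₀, a₂, ha₂, hdist₂⟩ := exists_measurable_code_dist_le (X := X) hρ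
  set a : X → Fin k × Fin m₀ := fun x => (a₁ x, a₂ x) with ha_def
  have ha : Measurable a := ha₁.prodMk ha₂
  obtain ⟨t, ht⟩ : ∃ t : ℝ, Fintype.card (Fin k × Fin m₀) * Real.exp (-t) ≤ ε := by
    have h : Tendsto (fun t : ℝ => Fintype.card (Fin k × Fin m₀) * Real.exp (-t)) atTop
        (𝓝 (Fintype.card (Fin k × Fin m₀) * 0)) :=
      (Real.tendsto_exp_atBot.comp tendsto_neg_atTop_atBot).const_mul _
    rw [mul_zero] at h
    exact ((h.eventually (gt_mem_nhds hε)).exists).imp fun _ h => h.le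
  obtain ⟨δ₁, hδ₁, D, hD, hDμ, hloc⟩ :=
    exists_exceptional_set μ ha (show 0 < ε / (|t| + 1) by positivity)
  have htD : t * μ.real D ≤ ε := by
    have h1 : t * μ.real D ≤ |t| * (ε / (|t| + 1)) :=
      mul_le_mul (le_abs_self t) hDμ measureReal_nonneg (abs_nonneg t)
    refine h1.trans ?_
    rw [mul_div_assoc', div_le_iff₀ (by positivity)]
    nlinarith [abs_nonneg t]
  obtain ⟨δ₂, hδ₂, hunif⟩ := Metric.uniformContinuous_iff.1
    (CompactSpace.uniformContinuous_of_continuous hf) ε hε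
  set δ : ℝ := min δ₁ (δ₂ / 2) with hδ_def
  have hδ : 0 < δ := lt_min hδ₁ (half_pos hδ₂)
  set γ : X → (Fin k × Fin m₀) × Bool := fun x => (a x, decide (x ∈ D)) with hγ_def
  have hγm : Measurable γ := ha.prodMk (measurable_to_bool (by
    rw [show (fun x => decide (x ∈ D)) ⁻¹' {true} = D by ext; simp]
    exact hD))
  have hη : ∀ x z, dist x z ≤ δ → f x ≤ f z + ε := fun x z hxz => by
    have h1 : dist x z < δ₂ :=
      (hxz.trans (min_le_right _ _)).trans_lt (half_lt_self hδ₂)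
    have h2 := (le_abs_self _).trans (hunif h1).le
    linarith
  have hγloc : ∀ z, ∃ i, ∀ x, dist x z ≤ δ → γ x = (i, false) ∨ (γ x).2 = true := fun z => by
    obtain ⟨i, hi⟩ := hloc z
    refine ⟨i, fun x hx => ?_⟩
    by_cases hxD : x ∈ D
    · exact Or.inr (by simp [hγ_def, hxD])
    · exact Or.inl (by simp [hγ_def, hxD, hi x (hx.trans (min_le_left _ _)) hxD])
  choose m' W' hW'm hW'd using fun j : ℕ =>
    exists_measurable_code_dist_le (X := X) (Nat.one_div_pos_of_nat (α := ℝ) (n := j))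
  set e := Fintype.equivFin ((Fin k × Fin m₀) × Bool)
  obtain ⟨m, W, r, hW, hWd, hr0, hr, hWγ⟩ : ∃ (m : ℕ → ℕ) (W : ∀ j, X → Fin (m j)) (r : ℕ → ℝ),
      (∀ j, Measurable (W j)) ∧ (∀ j x y, W j x = W j y → dist x y ≤ r j) ∧ r 0 = ρ ∧
      Tendsto r atTop (𝓝 0) ∧ ∀ x y, W 0 x = W 0 y ↔ γ x = γ y := by
    refine ⟨fun j => Nat.casesOn j (Fintype.card ((Fin k × Fin m₀) × Bool)) m',
      fun j => Nat.casesOn j (fun x => e (γ x)) W',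
      fun j => Nat.casesOn j ρ fun j => 1 / ((j : ℝ) + 1), ?_, ?_, rfl, ?_,
      fun x y => e.apply_eq_iff_eq⟩
    · rintro (_ | j)
      · exact (Measurable.of_discrete (f := e)).comp hγm
      · exact hW'm j
    · rintro (_ | j) x y hxy
      · exact hdist₂ x y (congrArg (fun s => s.1.2) (e.injective hxy))
      · exact hW'd j x y hxy
    · exact (tendsto_add_atTop_iff_nat 1).1 tendsto_one_div_add_atTop_nhds_zero_nat
  have hpoly := isShiftPolymatroid_shannon hT hW
  have hwin : ∀ n : ℕ, ∀ x y, jointCode W T (window (fun t => {(0, t)}) 0 n) x =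
      jointCode W T (window (fun t => {(0, t)}) 0 n) y ↔
      (fun i : Fin n => γ (T^[i] x)) = fun i : Fin n => γ (T^[i] y) := fun n x y => by
    rw [jointCode_eq_iff, funext_iff]
    constructor
    · intro h i
      have := h (0, (i : ℤ)) (mem_window.2 ⟨i, by positivity, by exact_mod_cast i.2,
        Finset.mem_singleton_self _⟩)
      rw [hWγ, Homeomorph.coe_zpow_natCast] at this
      exact this
    · intro h v hv
      obtain ⟨s, hs0, hsn, hvs⟩ := mem_window.1 hv
      obtain rfl := Finset.mem_singleton.1 hvs
      lift s to ℕ using hs0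
      have := h ⟨s, by exact_mod_cast hsn⟩
      rw [hWγ, Homeomorph.coe_zpow_natCast]
      exact this
  have hΓm : ∀ n : ℕ, Measurable fun x (i : Fin n) => γ (T^[i] x) := fun n =>
    measurable_pi_iff.2 fun i => hγm.comp (T.continuous.iterate _).measurable
  have hc₀ : ∀ n : ℕ, entPart μ T α * (n + 1) ≤
      shannon μ (jointCode W T (window (fun t => {(0, t)}) 0 (n + 1 : ℕ))) := fun n => by
    refine (entPart_mul_le_dynH μ T α n).trans ?_
    rw [hdyn]
    refine shannon_le_of_refines (measurable_jointCode hW _)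
      (measurable_pi_iff.2 fun i => ha₁.comp (T.continuous.iterate _).measurable) fun x y hxy => ?_
    have := (hwin (n + 1) x y).1 hxy
    exact funext fun i => congrArg (fun s => s.1.1) (congrFun this i)
  obtain ⟨F, hFm, hF0, hFj, hF⟩ := hpoly.exists_past (sub_lt_self (entPart μ T α) hε) hc₀
  refine ⟨m, W, r, F, δ, hδ, hW, hWd, hr0, hr, hFm, hF0, hFj, fun n N => ?_⟩
  set Y := jointCode W T (F N) with hY_def
  have hY : Measurable Y := measurable_jointCode hW _
  set φ : X → ℝ := fun x => f x - if (γ x).2 then t else 0 with hφ_def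
  have hφD : ∀ x, (if (γ x).2 then t else 0) = D.indicator (fun _ => t) x := fun x => by
    by_cases hx : x ∈ D <;> simp [hγ_def, hx]
  have hφi : Integrable φ μ := by
    simp only [hφ_def, hφD]
    exact hfi.sub ((integrable_const t).indicator hD)
  have hφint : ∫ x, φ x ∂μ = ∫ x, f x ∂μ - t * μ.real D := by
    simp only [hφ_def, hφD]
    rw [integral_sub hfi ((integrable_const t).indicator hD), integral_indicator_const _ hD,
      smul_eq_mul, mul_comm]
  obtain ⟨hui, huint⟩ := integral_birk hT hφi n
  choose R hR0 hRx hRsum using fun y => exists_name_weight (T := T) (t := t) hb hδ hη hγloc n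
    (Y ⁻¹' {y})
  have hgibbs := shannon_sub_add_integral_le (hΓm n) hY hui hR0 fun x => hRx (Y x) x rfl
  rw [huint, hφint] at hgibbs
  have hent : n * (entPart μ T α - ε) ≤
      shannon μ (fun x => ((fun i : Fin n => γ (T^[i] x)), Y x)) - shannon μ Y := by
    refine (hF n N).trans (sub_le_sub_right ?_ _)
    refine shannon_le_of_refines ((hΓm n).prodMk hY) (measurable_jointCode hW _) fun x y hxy => ?_
    have h1 := jointCode_eq_iff.1 ((hwin n x y).2 (congrArg Prod.fst hxy))
    have h2 := jointCode_eq_iff.1 (congrArg Prod.snd hxy)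
    exact jointCode_eq_iff.2 fun v hv => (Finset.mem_union.1 hv).elim (h1 v) (h2 v)
  have hlog : ∫ x, Real.log (∑ g, R (Y x) g) ∂μ ≤
      ∫ x, (n * (2 * ε) + Real.log (sepPn T f n δ (Y ⁻¹' {Y x}))) ∂μ := by
    refine integral_mono (integrable_comp_fintype hY fun y => Real.log (∑ g, R y g))
      ((integrable_const _).add
        (integrable_comp_fintype hY fun y => Real.log (sepPn T f n δ (Y ⁻¹' {y})))) fun x => ?_
    have hpos : 0 < ∑ g, R (Y x) g := ((Real.exp_pos _).trans_le (hRx (Y x) x rfl)).trans_le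
      (Finset.single_le_sum (fun g _ => hR0 (Y x) g) (Finset.mem_univ _))
    have hs : 0 < sepPn T f n δ (Y ⁻¹' {Y x}) := sepPn_pos hb hδ ⟨x, rfl⟩
    rw [Real.log_le_iff_le_exp hpos, Real.exp_add, Real.exp_log hs]
    refine (hRsum (Y x)).trans ?_
    gcongr
    rw [Real.exp_nat_mul, two_mul, Real.exp_add]
    gcongr
    linarith [Real.add_one_le_exp ε]
  rw [integral_add (integrable_const _)
    (integrable_comp_fintype hY fun y => Real.log (sepPn T f n δ (Y ⁻¹' {y})))] at hlog
  simp only [integral_const, probReal_univ, smul_eq_mul, one_mul] at hlog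
  have h3 : (n : ℝ) * (t * μ.real D) ≤ n * ε := by gcongr
  have h4 : (n : ℝ) * c = n * (entPart μ T α - ε) + n * ∫ x, f x ∂μ - n * ε - n * (2 * ε) := by
    rw [← sub_eq_iff_eq_add.2 hcε.symm]
    ring
  linarith

theorem le_measureReal_of_le_integral [MeasurableSpace X] {μ : Measure X} [IsProbabilityMeasure μ]
    {g : X → ℝ} (hg : Integrable g μ) {a c L : ℝ} (hs : MeasurableSet {x | a < g x})
    (hL : ∀ x, g x ≤ L) (hc : c ≤ ∫ x, g x ∂μ) : c - a ≤ (L - a) * μ.real {x | a < g x} := by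
  have h : ∫ x, g x ∂μ ≤ ∫ x, (a + {x | a < g x}.indicator (fun _ => L - a) x) ∂μ := by
    refine integral_mono hg ((integrable_const _).add ((integrable_const _).indicator hs))
      fun x => ?_
    by_cases hx : a < g x
    · simpa [hx] using hL x
    · simpa [hx] using not_lt.1 hx
  rw [integral_add (integrable_const _) ((integrable_const _).indicator hs),
    integral_indicator_const _ hs] at h
  simp only [integral_const, probReal_univ, smul_eq_mul, one_mul] at h
  linarith

/-- The limsup of a sequence of measurable sets of measure at least `κ` has measure at least
`κ`. -/
theorem le_measureReal_frequently [MeasurableSpace X] {μ : Measure X} [IsProbabilityMeasure μ]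
    {s : ℕ → Set X} (hs : ∀ n, MeasurableSet (s n)) {κ : ℝ} (h : ∀ᶠ n in atTop, κ ≤ μ.real (s n)) :
    MeasurableSet {x | ∃ᶠ n in atTop, x ∈ s n} ∧
      κ ≤ μ.real {x | ∃ᶠ n in atTop, x ∈ s n} := by
  have heq : {x | ∃ᶠ n in atTop, x ∈ s n} = ⋂ k, ⋃ n ≥ k, s n := by
    ext x
    simp [frequently_atTop]
  have hm : ∀ k, MeasurableSet (⋃ n ≥ k, s n) := fun k =>
    MeasurableSet.iUnion fun n => MeasurableSet.iUnion fun _ => hs n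
  rw [heq]
  refine ⟨MeasurableSet.iInter hm, ?_⟩
  have ht := tendsto_measure_iInter_atTop (μ := μ) (fun k => (hm k).nullMeasurableSet)
    (fun k l hkl => biUnion_subset_biUnion_left fun n (hn : n ≥ l) => hkl.trans hn)
    ⟨0, measure_ne_top _ _⟩
  refine ge_of_tendsto ((ENNReal.tendsto_toReal (measure_ne_top _ _)).comp ht) ?_
  filter_upwards with k
  obtain ⟨n, hn, hkn⟩ := (h.and (eventually_ge_atTop k)).exists
  exact hn.trans (measureReal_mono (subset_iUnion₂ (s := fun n (_ : n ≥ k) => s n) n hkn)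
    (measure_ne_top _ _))

/-- A set of positive measure of points whose `ρ`-local unstable sets contain closed subsets,
uniformly contracted in the past, of large pressure. -/
theorem exists_local_unstable_subset [MetricSpace X] [CompactSpace X] [MeasurableSpace X]
    [BorelSpace X] {μ : Measure X} [IsProbabilityMeasure μ] {T : X ≃ₜ X}
    (hT : MeasurePreserving T μ μ) {f : X → ℝ} (hf : Continuous f) {α : Finset (Set X)}
    (hα : IsFinPartition α) {c : ℝ} (hc : c < entPart μ T α + ∫ x, f x ∂μ) {ρ : ℝ} (hρ : 0 < ρ) :
    ∃ δ > 0, ∃ E : Set X, MeasurableSet E ∧ μ E ≠ 0 ∧ ∀ x ∈ E, ∃ B : Set X, IsClosed B ∧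
      (∀ y ∈ B, ∀ i, dist (T.symm^[i + 1] x) (T.symm^[i + 1] y) ≤ ρ) ∧
      (∀ ε > 0, ∀ᶠ i in atTop, ∀ y ∈ B, dist (T.symm^[i] x) (T.symm^[i] y) ≤ ε) ∧
      ∃ᶠ n : ℕ in atTop, Real.exp (n * c) ≤ sepPn T f n δ B := by
  obtain ⟨b, hb⟩ := exists_abs_le_of_continuous hf
  obtain ⟨c₂, hcc₂, hc₂⟩ := exists_between hc
  obtain ⟨m, W, r, F, δ, hδ, hW, hWr, hr0, hr, hFm, hF0, hFj, hint⟩ :=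
    exists_past_codes hT hf hα hc₂ hρ
  obtain ⟨L, hL⟩ := exists_sepPn_le T hb hδ
  set C : ℕ → X → Set X := fun N x => jointCode W T (F N) ⁻¹' {jointCode W T (F N) x} with hC
  have hCpos : ∀ n N x, 0 < sepPn T f n δ (C N x) := fun n N x => sepPn_pos hb hδ ⟨x, rfl⟩
  set A : ℕ → ℕ → Set X := fun n N => {x | n * c < Real.log (sepPn T f n δ (C N x))} with hA
  have hgm : ∀ n N, Integrable (fun x => Real.log (sepPn T f n δ (C N x))) μ ∧
      Measurable (fun x => Real.log (sepPn T f n δ (C N x))) := fun n N =>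
    ⟨integrable_comp_fintype (measurable_jointCode hW _)
      fun y => Real.log (sepPn T f n δ (jointCode W T (F N) ⁻¹' {y})),
    (Measurable.of_discrete
      (f := fun y => Real.log (sepPn T f n δ (jointCode W T (F N) ⁻¹' {y})))).comp
      (measurable_jointCode hW _)⟩
  have hAm : ∀ n N, MeasurableSet (A n N) := fun n N =>
    measurableSet_lt measurable_const (hgm n N).2
  set L' : ℝ := max L (c + 1) with hL'
  have hL'c : 0 < L' - c := by linarith [le_max_right L (c + 1)]
  set κ : ℝ := (c₂ - c) / (L' - c) with hκ
  have hκ0 : 0 < κ := div_pos (sub_pos.2 hcc₂) hL'c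
  have hAκ : ∀ n ≥ 1, ∀ N, κ ≤ μ.real (A n N) := fun n hn N => by
    have h0 : (0 : ℝ) < n := by exact_mod_cast hn
    have h1 := le_measureReal_of_le_integral (L := n * L') (hgm n N).1 (hAm n N) (fun x => by
      rw [Real.log_le_iff_le_exp (hCpos n N x)]
      refine (hL n _).trans (Real.exp_le_exp.2 ?_)
      gcongr
      exact le_max_left _ _) (hint n N)
    rw [← mul_sub, ← mul_sub, mul_assoc, mul_le_mul_iff_right₀ h0] at h1
    rw [hκ, div_le_iff₀ hL'c, mul_comm]
    exact h1
  have hCanti : ∀ x, Antitone fun N => C N x := fun x N N' hNN' y hy =>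
    jointCode_eq_iff.2 fun v hv => jointCode_eq_iff.1 hy v (hFm hNN' hv)
  have hAanti : ∀ n, Antitone (A n) := fun n N N' hNN' x hx =>
    lt_of_lt_of_le hx (Real.log_le_log (hCpos n N' x) (sepPn_mono hb hδ (hCanti x hNN')))
  have hinter : ∀ n ≥ 1, κ ≤ μ.real (⋂ N, A n N) := fun n hn => by
    have ht := tendsto_measure_iInter_atTop (μ := μ) (fun N => (hAm n N).nullMeasurableSet)
      (hAanti n) ⟨0, measure_ne_top _ _⟩
    exact ge_of_tendsto ((ENNReal.tendsto_toReal (measure_ne_top _ _)).comp ht)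
      (Eventually.of_forall fun N => hAκ n hn N)
  obtain ⟨hEm, hEκ⟩ := le_measureReal_frequently (μ := μ)
    (fun n => MeasurableSet.iInter (hAm n)) ((eventually_ge_atTop 1).mono hinter)
  refine ⟨δ / 2, half_pos hδ, _, hEm, fun h0 => ?_, fun x hx => ?_⟩
  · rw [measureReal_def, h0, ENNReal.toReal_zero] at hEκ
    exact hκ0.not_ge hEκ
  set K : ℕ → Set X := fun N => ⋂ v ∈ F N, {y | dist ((T ^ v.2) x) ((T ^ v.2) y) ≤ r v.1} with hK
  have hKcl : ∀ N, IsClosed (K N) := fun N => isClosed_biInter fun v _ =>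
    isClosed_le (continuous_const.dist (T ^ v.2).continuous) continuous_const
  have hKanti : Antitone K := fun N N' hNN' => biInter_subset_biInter_left (hFm hNN')
  have hCK : ∀ N, C N x ⊆ K N := fun N y hy => mem_iInter₂.2 fun v hv =>
    hWr _ _ _ (jointCode_eq_iff.1 hy v hv).symm
  have hmem : ∀ y ∈ ⋂ N, K N, ∀ N, ∀ v ∈ F N, dist ((T ^ v.2) x) ((T ^ v.2) y) ≤ r v.1 :=
    fun y hy N => mem_iInter₂.1 (mem_iInter.1 hy N)
  refine ⟨⋂ N, K N, isClosed_iInter hKcl, fun y hy i => ?_, fun ε hε => ?_, ?_⟩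
  · obtain ⟨N, hN⟩ := hF0 i
    have := hmem y hy N _ hN
    simp only [← Nat.cast_add_one, Homeomorph.coe_zpow_neg_natCast, hr0] at this
    exact this
  · obtain ⟨j, hj⟩ := (hr.eventually (gt_mem_nhds hε)).exists
    obtain ⟨k, hk⟩ := hFj j
    filter_upwards [eventually_ge_atTop k] with i hi y hy
    obtain ⟨N, hN⟩ := hk i hi
    have := hmem y hy N _ hN
    simp only [Homeomorph.coe_zpow_neg_natCast] at this
    exact this.trans hj.le
  · refine hx.mono fun n hn => ?_
    refine le_sepPn_iInter T.continuous hf (half_pos hδ) (half_lt_self hδ) hKcl hKanti fun N => ?_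
    have h1 := (Real.lt_log_iff_exp_lt (hCpos n N x)).1 (mem_iInter.1 hn N)
    exact h1.trans_le (sepPn_mono hb hδ (hCK N))

theorem Ergodic.ae_exists_iterate_succ_mem [MeasurableSpace X] {μ : Measure X}
    [IsProbabilityMeasure μ] {T : X → X} (hT : Ergodic T μ) {E : Set X} (hE : MeasurableSet E)
    (hμE : μ E ≠ 0) : ∀ᵐ x ∂μ, ∃ n : ℕ, T^[n + 1] x ∈ E := by
  set U : Set X := ⋃ n : ℕ, T^[n + 1] ⁻¹' E with hU
  have hUm : MeasurableSet U := MeasurableSet.iUnion fun n => (hT.measurable.iterate _) hE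
  have hsub : T ⁻¹' U ⊆ U := fun x hx => by
    obtain ⟨n, hn⟩ := mem_iUnion.1 hx
    exact mem_iUnion.2 ⟨n + 1, hn⟩
  rcases hT.ae_empty_or_univ_of_preimage_ae_le hUm.nullMeasurableSet
    hsub.eventuallyLE with h | h
  · have h1 : μ (T ⁻¹' E) ≤ μ U := measure_mono (subset_iUnion (fun n => T^[n + 1] ⁻¹' E) 0)
    rw [hT.measure_preimage hE.nullMeasurableSet, ae_eq_empty.1 h] at h1
    exact absurd (le_bot_iff.1 h1) hμE
  · filter_upwards [h.mem_iff] with x hx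
    exact mem_iUnion.1 (hx.2 trivial)

theorem isClosed_insert_iUnion_of_subset_closedBall [MetricSpace X] {x : X} {B : ℕ → Set X}
    (hB : ∀ i, IsClosed (B i)) (hx : ∀ i : ℕ, B i ⊆ Metric.closedBall x (1 / (i + 1))) :
    IsClosed (insert x (⋃ i, B i)) := by
  have heq : insert x (⋃ i, B i) =
      ⋂ k : ℕ, ((⋃ i ∈ Finset.range k, B i) ∪ Metric.closedBall x (1 / (k + 1))) := by
    refine Subset.antisymm (subset_iInter fun k => insert_subset (Or.inr ?_)
      (iUnion_subset fun i => ?_)) fun y hy => ?_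
    · exact Metric.mem_closedBall_self (by positivity)
    · rcases lt_or_ge i k with h | h
      · exact (subset_biUnion_of_mem (u := B) (Finset.mem_range.2 h)).trans subset_union_left
      · exact ((hx i).trans (Metric.closedBall_subset_closedBall (by gcongr))).trans
          subset_union_right
    · by_cases hyB : y ∈ ⋃ i, B i
      · exact Or.inr hyB
      · refine Or.inl (dist_le_zero.1 ?_)
        refine ge_of_tendsto tendsto_one_div_add_atTop_nhds_zero_nat
          (Eventually.of_forall fun k => ?_)
        exact (mem_iInter.1 hy k).resolve_left fun h =>
          hyB (iUnion₂_subset_iUnion _ _ h)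
  rw [heq]
  exact isClosed_iInter fun k => (isClosed_biUnion_finset fun i _ => hB i).union
    Metric.isClosed_closedBall

theorem exists_isFinPartition_of_lt_mPres [MeasurableSpace X] {μ : Measure X} {T : X → X}
    {f : X → ℝ} {c : ℝ} (hc : (c : EReal) < mPres μ T f) :
    ∃ α, IsFinPartition α ∧ c < entPart μ T α + ∫ x, f x ∂μ := by
  have h : ((c - ∫ x, f x ∂μ : ℝ) : EReal) < mEnt μ T := by
    rw [EReal.coe_sub]
    exact EReal.sub_lt_of_lt_add hc
  obtain ⟨α, hα⟩ := lt_iSup_iff.1 h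
  obtain ⟨hα', hlt⟩ := lt_iSup_iff.1 hα
  exact ⟨α, hα', sub_lt_iff_lt_add.1 (EReal.coe_lt_coe_iff.1 hlt)⟩

/-- Almost every point has, at every scale `ρ`, a closed subset of its local unstable set whose
pressure exceeds any prescribed number below the measure-theoretic pressure. -/
theorem ae_exists_unstable_subset [MetricSpace X] [CompactSpace X] [MeasurableSpace X]
    [BorelSpace X] {μ : Measure X} [IsProbabilityMeasure μ] {T : X ≃ₜ X} (hT : Ergodic T μ)
    {f : X → ℝ} (hf : Continuous f) {c : ℝ} (hc : (c : EReal) < mPres μ T f) {ρ : ℝ}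
    (hρ : 0 < ρ) :
    ∀ᵐ x ∂μ, ∃ B : Set X, IsClosed B ∧ (∀ y ∈ B, ∀ i, dist (T.symm^[i] x) (T.symm^[i] y) ≤ ρ) ∧
      (∀ ε > 0, ∀ᶠ i in atTop, ∀ y ∈ B, dist (T.symm^[i] x) (T.symm^[i] y) ≤ ε) ∧
      ∃ δ > 0, ∃ᶠ n : ℕ in atTop, Real.exp (n * c) ≤ sepPn T f n δ B := by
  obtain ⟨b, hb⟩ := exists_abs_le_of_continuous hf
  obtain ⟨α, hα, hcα⟩ := exists_isFinPartition_of_lt_mPres hc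
  obtain ⟨c', hcc', hc'⟩ := exists_between hcα
  obtain ⟨δ, hδ, E, hE, hμE, hEB⟩ :=
    exists_local_unstable_subset hT.toMeasurePreserving hf hα hc' hρ
  filter_upwards [hT.ae_exists_iterate_succ_mem hE hμE] with x ⟨k, hk⟩
  obtain ⟨B, hB, hBρ, hBε, hBn⟩ := hEB _ hk
  have hback : ∀ i z, T.symm^[i + (k + 1)] (T^[k + 1] z) = T.symm^[i] z := fun i z => by
    rw [Function.iterate_add_apply,
      (Function.LeftInverse.iterate T.symm_apply_apply (k + 1)) z]
  refine ⟨T^[k + 1] ⁻¹' B, hB.preimage (T.continuous.iterate _), fun y hy i => ?_, fun ε hε => ?_,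
    δ, hδ, ?_⟩
  · have := hBρ _ hy (i + k)
    rwa [add_assoc, hback, hback] at this
  · filter_upwards [(tendsto_add_atTop_nat (k + 1)).eventually (hBε ε hε)] with i hi y hy
    have := hi _ hy
    rwa [hback, hback] at this
  · refine frequently_le_sepPn_of_image hb hδ hcc' (k + 1) ?_
    rwa [image_preimage_eq _ (T.surjective.iterate _)]

/-- For a TDS `(X,T)`, `f ∈ C(X,ℝ)` and an ergodic `T`-invariant
Borel probability measure `μ` with `h_μ(T) > 0`: for `μ`-a.e. `x` there is a
closed `B(x) ⊆ W^u(x,T)` with `diam(T^{-n}B(x)) → 0` and `P(T,f,B(x)) ≥ P_μ(T,f)`.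
(Here `W^u(x,T) = W^s(x,T⁻¹)`.) -/
theorem stmt10 [MetricSpace X] [CompactSpace X] [MeasurableSpace X] [BorelSpace X]
    (T : X ≃ₜ X) (f : C(X, ℝ)) (μ : Measure X) [IsProbabilityMeasure μ]
    (herg : Ergodic ⇑T μ) (hpos : 0 < mEnt μ ⇑T) :
    ∀ᵐ x ∂μ, ∃ B : Set X, IsClosed B ∧ B ⊆ stableSet ⇑T.symm x ∧
      Tendsto (fun n : ℕ => Metric.diam ((⇑T.symm)^[n] '' B)) atTop (𝓝 0) ∧
      mPres μ ⇑T ⇑f ≤ pres ⇑T ⇑f B := by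
  obtain ⟨b, hb⟩ : ∃ b, ∀ x, |f x| ≤ b := ⟨‖f‖, f.norm_coe_le_norm⟩
  set q : ℕ → ℚ := fun j => (Denumerable.eqv ℚ).symm j
  have hall : ∀ᵐ x ∂μ, ∀ j : ℕ, ∃ B : Set X, IsClosed B ∧
      (∀ y ∈ B, ∀ i, dist (T.symm^[i] x) (T.symm^[i] y) ≤ 1 / (j + 1)) ∧
      (∀ ε > 0, ∀ᶠ i in atTop, ∀ y ∈ B, dist (T.symm^[i] x) (T.symm^[i] y) ≤ ε) ∧
      (((q j : ℝ) : EReal) < mPres μ T f →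
        ∃ δ > 0, ∃ᶠ n : ℕ in atTop, Real.exp (n * q j) ≤ sepPn T f n δ B) := by
    refine ae_all_iff.2 fun j => ?_
    by_cases hj : ((q j : ℝ) : EReal) < mPres μ T f
    · filter_upwards [ae_exists_unstable_subset herg f.continuous hj
        (Nat.one_div_pos_of_nat (α := ℝ) (n := j))] with x ⟨B, h1, h2, h3, h4⟩
      exact ⟨B, h1, h2, h3, fun _ => h4⟩
    · exact ae_of_all _ fun x => ⟨∅, isClosed_empty, by simp, by simp, fun h => absurd h hj⟩
  filter_upwards [hall] with x hx
  choose B hB hBd hBε hBq using hx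
  have hcontr : ∀ ε > 0, ∀ᶠ i in atTop, ∀ y ∈ insert x (⋃ j, B j),
      dist (T.symm^[i] x) (T.symm^[i] y) ≤ ε := fun ε hε => by
    obtain ⟨k, hk⟩ := exists_nat_one_div_lt hε
    filter_upwards [(eventually_all_finset (Finset.range k)).2 fun j _ => hBε j ε hε]
      with i hi y hy
    rcases hy with rfl | hy
    · simpa using hε.le
    · obtain ⟨j, hj⟩ := mem_iUnion.1 hy
      rcases lt_or_ge j k with h | h
      · exact hi j (Finset.mem_range.2 h) y hj
      · refine ((hBd j y hj i).trans ?_).trans hk.le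
        gcongr
  refine ⟨insert x (⋃ j, B j), isClosed_insert_iUnion_of_subset_closedBall hB fun j y hy => ?_,
    fun y hy => ?_, ?_, ?_⟩
  · rw [Metric.mem_closedBall, dist_comm]
    exact hBd j y hy 0
  · refine Metric.tendsto_nhds.2 fun ε hε => ?_
    filter_upwards [hcontr (ε / 2) (half_pos hε)] with i hi
    rw [Real.dist_0_eq_abs, abs_of_nonneg dist_nonneg]
    linarith [hi y hy]
  · refine Metric.tendsto_nhds.2 fun ε hε => ?_
    filter_upwards [hcontr (ε / 4) (by positivity)] with i hi
    rw [Real.dist_0_eq_abs, abs_of_nonneg Metric.diam_nonneg]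
    refine (Metric.diam_le_of_forall_dist_le (C := ε / 2) (by positivity) ?_).trans_lt
      (half_lt_self hε)
    rintro _ ⟨y, hy, rfl⟩ _ ⟨z, hz, rfl⟩
    linarith [dist_triangle_left (T.symm^[i] y) (T.symm^[i] z) (T.symm^[i] x), hi y hy, hi z hz]
  · by_contra! hlt
    obtain ⟨p, hp, hp'⟩ := EReal.lt_iff_exists_rat_btwn.1 hlt
    obtain ⟨j, rfl⟩ : ∃ j, q j = p := (Denumerable.eqv ℚ).symm.surjective p
    obtain ⟨δ, hδ, hfreq⟩ := hBq j hp'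
    refine hp.not_ge (le_pres_of_frequently hδ (hfreq.mono fun n hn => hn.trans ?_))
    exact sepPn_mono hb hδ ((subset_iUnion B j).trans (subset_insert _ _))
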